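/- arXiv:math/0405415 — 12 statements merged into one kernel-verified Lean document; each statement's English description precedes it below -/
import Mathlib

section
/- Let M ∈ GL₂(K) be such that tr M and det M lie in A, and suppose that the reduction modulo m of the polynomial X² − (tr M)·X + det M has two distinct roots α₁ ≠ α₂ in k. Then there exist λ₁, λ₂ ∈ A with λ₁ + λ₂ = tr M, λ₁·λ₂ = det M, λᵢ mod m = αᵢ (i = 1, 2), λ₁ − λ₂ a unit of A, and there exists P ∈ GL₂(K) such that P⁻¹ M P is the diagonal matrix diag(λ₁, λ₂). -/
open Polynomial in
/-- In a Henselian local ring, a monic quadratic whose reduction has two distinct roots splits,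
with roots lifting those of the reduction. -/
theorem HenselianLocalRing.exists_add_eq_mul_eq_residue_eq
    {A : Type*} [CommRing A] [HenselianLocalRing A] {t d : A}
    {α₁ α₂ : IsLocalRing.ResidueField A} (hne : α₁ ≠ α₂)
    (hroot₁ : α₁ ^ 2 - IsLocalRing.residue A t * α₁ + IsLocalRing.residue A d = 0)
    (hroot₂ : α₂ ^ 2 - IsLocalRing.residue A t * α₂ + IsLocalRing.residue A d = 0) :
    ∃ lam₁ lam₂ : A, lam₁ + lam₂ = t ∧ lam₁ * lam₂ = d ∧
      IsLocalRing.residue A lam₁ = α₁ ∧ IsLocalRing.residue A lam₂ = α₂ := by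
  have hsum : α₁ + α₂ = IsLocalRing.residue A t :=
    mul_left_cancel₀ (sub_ne_zero.mpr hne) (by linear_combination hroot₁ - hroot₂)
  have hmonic : (X ^ 2 - C t * X + C d : A[X]).Monic := by monicity!
  have hlift : ∀ f : A[X], f.Monic → ∀ a₀ : IsLocalRing.ResidueField A, aeval a₀ f = 0 →
      aeval a₀ (derivative f) ≠ 0 → ∃ a : A, f.IsRoot a ∧ IsLocalRing.residue A a = a₀ :=
    ((HenselianLocalRing.TFAE A).out 0 1).mp ‹_›
  obtain ⟨lam, hlam, hres⟩ := hlift _ hmonic α₁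
    (by simpa [IsLocalRing.ResidueField.algebraMap_eq] using hroot₁)
    (by
      have : 2 * α₁ - IsLocalRing.residue A t ≠ 0 := by
        rw [← hsum]
        exact fun h ↦ hne (by linear_combination h)
      simpa [IsLocalRing.ResidueField.algebraMap_eq, one_add_one_eq_two,
        map_ofNat (IsLocalRing.residue A) 2]
      using this)
  have hlam' : lam ^ 2 - t * lam + d = 0 := by simpa [IsRoot.def] using hlam
  refine ⟨lam, t - lam, by ring, by linear_combination -hlam', hres, ?_⟩
  rw [map_sub, hres, ← hsum]
  ring

/-- Over a semilocal ring, a binary quadratic form whose coefficients generate the unit ideal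
represents a unit. -/
theorem exists_isUnit_binary_quadratic_form {R : Type*} [CommRing R] [Finite (MaximalSpectrum R)]
    {a b c : R} (h : ∀ I : Ideal R, I.IsMaximal → a ∈ I → c ∈ I → b ∉ I) :
    ∃ x y : R, IsUnit (a * x ^ 2 + b * (x * y) + c * y ^ 2) := by
  have hlocal (I : MaximalSpectrum R) :
      ∃ x y : R, a * x ^ 2 + b * (x * y) + c * y ^ 2 ∉ I.asIdeal := by
    by_cases ha : a ∈ I.asIdeal
    · by_cases hc : c ∈ I.asIdeal
      · refine ⟨1, 1, fun hmem ↦ h _ I.isMaximal ha hc ?_⟩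
        convert I.asIdeal.sub_mem (I.asIdeal.sub_mem hmem ha) hc using 1
        ring
      · exact ⟨0, 1, by simpa using hc⟩
    · exact ⟨1, 0, by simpa using ha⟩
  choose x y hxy using hlocal
  have hcop : Pairwise (Function.onFun IsCoprime (MaximalSpectrum.asIdeal (R := R))) :=
    fun I J hIJ ↦ Ideal.isCoprime_of_isMaximal fun hEq ↦ hIJ (MaximalSpectrum.ext hEq)
  obtain ⟨r, hr⟩ := Ideal.exists_forall_sub_mem_ideal hcop x
  obtain ⟨s, hs⟩ := Ideal.exists_forall_sub_mem_ideal hcop y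
  refine ⟨r, s, by_contra fun hu ↦ ?_⟩
  obtain ⟨I, hI, hmem⟩ := exists_max_ideal_of_mem_nonunits hu
  let J : MaximalSpectrum R := ⟨I, hI⟩
  have hrJ : Ideal.Quotient.mk I r = Ideal.Quotient.mk I (x J) := Ideal.Quotient.eq.mpr (hr J)
  have hsJ : Ideal.Quotient.mk I s = Ideal.Quotient.mk I (y J) := Ideal.Quotient.eq.mpr (hs J)
  refine hxy J (Ideal.Quotient.eq_zero_iff_mem.mp ?_)
  have hzero := Ideal.Quotient.eq_zero_iff_mem.mpr hmem
  simp only [map_add, map_mul, map_pow, hrJ, hsJ] at hzero ⊢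
  exact hzero

/-- Over a semilocal ring, a `2 × 2` matrix whose characteristic polynomial is
`(X - u) * (X - v)` with `u - v` a unit is diagonalizable. -/
theorem Matrix.exists_conj_eq_diagonal_of_isUnit_sub
    {R : Type*} [CommRing R] [Finite (MaximalSpectrum R)]
    (M : GL (Fin 2) R) {u v : R}
    (htr : u + v = Matrix.trace (M : Matrix (Fin 2) (Fin 2) R))
    (hdet : u * v = Matrix.det (M : Matrix (Fin 2) (Fin 2) R)) (huv : IsUnit (u - v)) :
    ∃ P : GL (Fin 2) R, ((P⁻¹ * M * P : GL (Fin 2) R) : Matrix (Fin 2) (Fin 2) R)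
      = Matrix.diagonal ![u, v] := by
  rw [Matrix.trace_fin_two] at htr
  rw [Matrix.det_fin_two] at hdet
  set N : Matrix (Fin 2) (Fin 2) R := M.val
  obtain ⟨x, y, hxy⟩ := exists_isUnit_binary_quadratic_form
    (a := N 1 0) (b := N 1 1 - N 0 0) (c := -N 0 1) (by
      intro I hI h10 h01 hsub
      refine hI.ne_top (I.eq_top_of_isUnit_mem ?_ (huv.pow 2))
      have hdisc : (u - v) ^ 2 = (N 1 1 - N 0 0) * (N 1 1 - N 0 0) + 4 * N 0 1 * N 1 0 := by
        linear_combination (u + v + N 0 0 + N 1 1) * htr - 4 * hdet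
      rw [hdisc]
      exact I.add_mem (I.mul_mem_left _ hsub) (I.mul_mem_left _ h10))
  -- The columns are `(N - v) w` and `(N - u) w` for `w = (x, y)`.
  let Q : Matrix (Fin 2) (Fin 2) R :=
    !![(N 0 0 - v) * x + N 0 1 * y, (N 0 0 - u) * x + N 0 1 * y;
       N 1 0 * x + (N 1 1 - v) * y, N 1 0 * x + (N 1 1 - u) * y]
  have hQ : IsUnit Q.det := by
    convert huv.mul hxy using 1
    rw [Matrix.det_fin_two_of]
    ring
  refine ⟨Matrix.GeneralLinearGroup.mk'' Q hQ, ?_⟩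
  have hNQ : N * Q = Q * Matrix.diagonal ![u, v] := by
    ext i j
    fin_cases i <;> fin_cases j <;> simp [Q, Matrix.mul_apply, Fin.sum_univ_two]
    · linear_combination -N 0 0 * x * htr + x * hdet - N 0 1 * y * htr
    · linear_combination -N 0 0 * x * htr + x * hdet - N 0 1 * y * htr
    · linear_combination -N 1 0 * x * htr + y * hdet - N 1 1 * y * htr
    · linear_combination -N 1 0 * x * htr + y * hdet - N 1 1 * y * htr
  rw [mul_assoc, Units.val_mul, Units.inv_mul_eq_iff_eq_mul]
  exact hNQ

/-- The total ring of fractions of a Noetherian ring is semilocal. -/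
theorem IsFractionRing.finite_maximalSpectrum (A K : Type*) [CommRing A] [IsNoetherianRing A]
    [CommRing K] [Algebra A K] [IsFractionRing A K] : Finite (MaximalSpectrum K) := by
  have := IsLocalization.isNoetherianRing (nonZeroDivisors A) K ‹_›
  have : IsFractionRing K K := idem A K
  infer_instance

/-- Over a reduced Noetherian Henselian local ring `A` with total fraction ring `K`:
if `M ∈ GL₂(K)` has trace and determinant in `A` and the reduction mod `m` of
`X² − (tr M)X + det M` has two distinct roots `α₁ ≠ α₂` in the residue field, then the
characteristic polynomial splits in `A` with roots `λ₁, λ₂` lifting `α₁, α₂`, with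
`λ₁ − λ₂` a unit, and `M` is diagonalizable: `P⁻¹ M P = diag(λ₁, λ₂)` for some
`P ∈ GL₂(K)`. -/
theorem exists_adapted_basis_diagonalizing
    {A K : Type*} [CommRing A] [IsReduced A] [IsNoetherianRing A] [IsLocalRing A]
    [HenselianLocalRing A] [CommRing K] [Algebra A K]
    [IsLocalization (nonZeroDivisors A) K]
    (M : Matrix.GeneralLinearGroup (Fin 2) K) (t d : A)
    (ht : algebraMap A K t = Matrix.trace (M : Matrix (Fin 2) (Fin 2) K))
    (hd : algebraMap A K d = Matrix.det (M : Matrix (Fin 2) (Fin 2) K))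
    (α₁ α₂ : IsLocalRing.ResidueField A) (hne : α₁ ≠ α₂)
    (hroot₁ : α₁ ^ 2 - IsLocalRing.residue A t * α₁ + IsLocalRing.residue A d = 0)
    (hroot₂ : α₂ ^ 2 - IsLocalRing.residue A t * α₂ + IsLocalRing.residue A d = 0) :
    ∃ lam₁ lam₂ : A,
      lam₁ + lam₂ = t ∧
      lam₁ * lam₂ = d ∧
      IsLocalRing.residue A lam₁ = α₁ ∧
      IsLocalRing.residue A lam₂ = α₂ ∧
      IsUnit (lam₁ - lam₂) ∧
      ∃ P : Matrix.GeneralLinearGroup (Fin 2) K,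
        ((P⁻¹ * M * P : Matrix.GeneralLinearGroup (Fin 2) K) : Matrix (Fin 2) (Fin 2) K)
          = Matrix.diagonal ![algebraMap A K lam₁, algebraMap A K lam₂] := by
  obtain ⟨lam₁, lam₂, hsum, hprod, hres₁, hres₂⟩ :=
    HenselianLocalRing.exists_add_eq_mul_eq_residue_eq hne hroot₁ hroot₂
  have hunit : IsUnit (lam₁ - lam₂) := by
    rw [← IsLocalRing.residue_ne_zero_iff_isUnit, map_sub, hres₁, hres₂]
    exact sub_ne_zero.mpr hne
  have : Finite (MaximalSpectrum K) := IsFractionRing.finite_maximalSpectrum A K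
  refine ⟨lam₁, lam₂, hsum, hprod, hres₁, hres₂, hunit,
    Matrix.exists_conj_eq_diagonal_of_isUnit_sub M ?_ ?_ ?_⟩
  · rw [← ht, ← hsum, map_add]
  · rw [← hd, ← hprod, map_mul]
  · rw [← map_sub]
    exact hunit.map (algebraMap A K)
end

section
/- For every g ∈ G, the matrix entries a(g) and d(g) lie in A, the reduction of a(g) modulo I equals ψ₁(g), and the reduction of d(g) modulo I equals ψ₂(g). -/
/-- Two pairs of ring elements with equal power sums of degrees one, two and three agree, provided
`l₁ - l₂` and `p₁ - l₂` are units. No assumption on the characteristic is needed. -/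
theorem eq_and_eq_of_power_sums_eq {R : Type*} [CommRing R] {l₁ l₂ p₁ p₂ : R}
    (h₁ : l₁ + l₂ = p₁ + p₂) (h₂ : l₁ ^ 2 + l₂ ^ 2 = p₁ ^ 2 + p₂ ^ 2)
    (h₃ : l₁ ^ 3 + l₂ ^ 3 = p₁ ^ 3 + p₂ ^ 3)
    (hl : IsUnit (l₁ - l₂)) (hp : IsUnit (p₁ - l₂)) : p₁ = l₁ ∧ p₂ = l₂ := by
  obtain rfl : p₂ = l₁ + l₂ - p₁ := by linear_combination -h₁
  have hprod : (p₁ - l₂) * (p₁ - l₁) = 0 := by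
    apply hl.mul_left_cancel
    linear_combination (-2 * l₁ - l₂) * h₂ + h₃
  have hpl : p₁ - l₁ = 0 := hp.mul_left_cancel (by rw [hprod, mul_zero])
  exact ⟨by linear_combination hpl, by linear_combination -hpl⟩

/-- Mazur–Wiles: the diagonal entries `a(g)`, `d(g)` of `ρ(g)` lie in `A`,
and their reductions mod `I` are `ψ₁(g)` and `ψ₂(g)` respectively. -/
theorem diagonal_entries_in_A_and_reduce_to_psi
    {G : Type*} [Group G]
    {A K : Type*} [CommRing A] [IsReduced A] [IsNoetherianRing A] [IsLocalRing A]
    [HenselianLocalRing A] [CommRing K] [Algebra A K]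
    [IsLocalization (nonZeroDivisors A) K]
    (ρ : G →* Matrix.GeneralLinearGroup (Fin 2) K)
    (T dt : G → A)
    (hT : ∀ g, algebraMap A K (T g) = Matrix.trace (ρ g : Matrix (Fin 2) (Fin 2) K))
    (hdt : ∀ g, algebraMap A K (dt g) = Matrix.det (ρ g : Matrix (Fin 2) (Fin 2) K))
    (χ₁ χ₂ : G →* (IsLocalRing.ResidueField A)ˣ)
    (hχ : χ₁ ≠ χ₂)
    (hTχ : ∀ g, IsLocalRing.residue A (T g)
      = (χ₁ g : IsLocalRing.ResidueField A) + (χ₂ g : IsLocalRing.ResidueField A))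
    (s : G) (hs : χ₁ s ≠ χ₂ s)
    (lam₁ lam₂ : Aˣ)
    (hlam₁ : IsLocalRing.residue A (lam₁ : A) = χ₁ s)
    (hlam₂ : IsLocalRing.residue A (lam₂ : A) = χ₂ s)
    (hρs : (ρ s : Matrix (Fin 2) (Fin 2) K)
      = Matrix.diagonal ![algebraMap A K (lam₁ : A), algebraMap A K (lam₂ : A)])
    (I : Ideal A) (hI : I ≠ ⊤)
    (ψ₁ ψ₂ : G →* (A ⧸ I)ˣ)
    (hTψ : ∀ g, Ideal.Quotient.mk I (T g) = (ψ₁ g : A ⧸ I) + (ψ₂ g : A ⧸ I))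
    (hψ₁ : ∀ g, ∀ x : A, Ideal.Quotient.mk I x = (ψ₁ g : A ⧸ I) →
      IsLocalRing.residue A x = χ₁ g)
    (hψ₂ : ∀ g, ∀ x : A, Ideal.Quotient.mk I x = (ψ₂ g : A ⧸ I) →
      IsLocalRing.residue A x = χ₂ g)
    (g : G) :
    ∃ aA dA : A,
      algebraMap A K aA = (ρ g : Matrix (Fin 2) (Fin 2) K) 0 0 ∧
      algebraMap A K dA = (ρ g : Matrix (Fin 2) (Fin 2) K) 1 1 ∧
      Ideal.Quotient.mk I aA = (ψ₁ g : A ⧸ I) ∧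
      Ideal.Quotient.mk I dA = (ψ₂ g : A ⧸ I) := by
  have hinj : Function.Injective (algebraMap A K) := IsLocalization.injective K le_rfl
  have hTs (n : ℕ) : T (s ^ n) = (lam₁ : A) ^ n + (lam₂ : A) ^ n := by
    apply hinj
    rw [hT, map_pow, Units.val_pow_eq_pow_val, hρs, Matrix.diagonal_pow]
    simp
  have hχs : (χ₁ s : IsLocalRing.ResidueField A) - χ₂ s ≠ 0 :=
    sub_ne_zero.mpr fun h => hs (Units.ext h)
  have hunit : IsUnit ((lam₁ : A) - lam₂) := by
    rwa [← IsLocalRing.residue_ne_zero_iff_isUnit, map_sub, hlam₁, hlam₂]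
  have hunit' : IsUnit ((ψ₁ s : A ⧸ I) - Ideal.Quotient.mk I lam₂) := by
    obtain ⟨p, hp⟩ := Ideal.Quotient.mk_surjective (ψ₁ s : A ⧸ I)
    rw [← hp, ← map_sub]
    apply IsUnit.map
    rwa [← IsLocalRing.residue_ne_zero_iff_isUnit, map_sub, hψ₁ s p hp, hlam₂]
  have hpow (n : ℕ) : Ideal.Quotient.mk I lam₁ ^ n + Ideal.Quotient.mk I lam₂ ^ n
      = (ψ₁ s : A ⧸ I) ^ n + (ψ₂ s : A ⧸ I) ^ n := by
    simpa [hTs] using hTψ (s ^ n)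
  obtain ⟨hs₁, hs₂⟩ := eq_and_eq_of_power_sums_eq (by simpa using hpow 1) (hpow 2) (hpow 3)
    (by simpa using hunit.map (Ideal.Quotient.mk I)) hunit'
  have htr := hT g
  rw [Matrix.trace_fin_two] at htr
  have htrs : algebraMap A K (T (s * g)) = algebraMap A K lam₁ * (ρ g).val 0 0
      + algebraMap A K lam₂ * (ρ g).val 1 1 := by
    rw [hT, map_mul, Units.val_mul, hρs, Matrix.trace_fin_two]
    simp [Matrix.diagonal_mul]
  have hψg := hTψ g
  have hψsg := hTψ (s * g)
  simp only [map_mul, Units.val_mul, hs₁, hs₂] at hψsg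
  obtain ⟨u, hu⟩ := hunit.exists_right_inv
  have huK := congrArg (algebraMap A K) hu
  have huI := congrArg (Ideal.Quotient.mk I) hu
  simp only [map_mul, map_sub, map_one] at huK huI
  refine ⟨u * (T (s * g) - lam₂ * T g), u * (lam₁ * T g - T (s * g)), ?_, ?_, ?_, ?_⟩ <;>
    simp only [map_mul, map_sub]
  · rw [htrs, htr]
    linear_combination (ρ g).val 0 0 * huK
  · rw [htrs, htr]
    linear_combination (ρ g).val 1 1 * huK
  · rw [hψsg, hψg]
    linear_combination (ψ₁ g : A ⧸ I) * huI
  · rw [hψsg, hψg]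
    linear_combination (ψ₂ g : A ⧸ I) * huI
end

section
/- For all g, g' ∈ G, the product b(g)·c(g') lies in A and in fact lies in the ideal I. -/
/-- In a commutative ring, two pairs with the same first three power sums coincide as soon as the
relevant differences are invertible; no assumption on the characteristic is needed. -/
lemma eq_of_power_sums_eq {R : Type*} [CommRing R] {p q t u : R}
    (h1 : t + u = p + q) (h2 : t ^ 2 + u ^ 2 = p ^ 2 + q ^ 2) (h3 : t ^ 3 + u ^ 3 = p ^ 3 + q ^ 3)
    (htq : IsUnit (t - q)) (hpq : IsUnit (p - q)) : t = p := by
  obtain rfl : u = p + q - t := by linear_combination h1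
  have key : (t - q) * ((p - q) * (t - p)) = 0 := by
    linear_combination h3 - (p + 2 * q) * h2
  exact sub_eq_zero.mp (hpq.mul_right_eq_zero.mp (htq.mul_right_eq_zero.mp key))

/-- Mazur–Wiles: for all `g, g' ∈ G` the product `b(g)·c(g')` of off-diagonal entries
lies in `A`, and in fact in the ideal `I`. -/
theorem offdiagonal_product_in_I
    {G : Type*} [Group G]
    {A K : Type*} [CommRing A] [IsReduced A] [IsNoetherianRing A] [IsLocalRing A]
    [HenselianLocalRing A] [CommRing K] [Algebra A K]
    [IsLocalization (nonZeroDivisors A) K]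
    (ρ : G →* Matrix.GeneralLinearGroup (Fin 2) K)
    (T dt : G → A)
    (hT : ∀ g, algebraMap A K (T g) = Matrix.trace (ρ g : Matrix (Fin 2) (Fin 2) K))
    (hdt : ∀ g, algebraMap A K (dt g) = Matrix.det (ρ g : Matrix (Fin 2) (Fin 2) K))
    (χ₁ χ₂ : G →* (IsLocalRing.ResidueField A)ˣ)
    (hχ : χ₁ ≠ χ₂)
    (hTχ : ∀ g, IsLocalRing.residue A (T g)
      = (χ₁ g : IsLocalRing.ResidueField A) + (χ₂ g : IsLocalRing.ResidueField A))
    (s : G) (hs : χ₁ s ≠ χ₂ s)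
    (lam₁ lam₂ : Aˣ)
    (hlam₁ : IsLocalRing.residue A (lam₁ : A) = χ₁ s)
    (hlam₂ : IsLocalRing.residue A (lam₂ : A) = χ₂ s)
    (hρs : (ρ s : Matrix (Fin 2) (Fin 2) K)
      = Matrix.diagonal ![algebraMap A K (lam₁ : A), algebraMap A K (lam₂ : A)])
    (I : Ideal A) (hI : I ≠ ⊤)
    (ψ₁ ψ₂ : G →* (A ⧸ I)ˣ)
    (hTψ : ∀ g, Ideal.Quotient.mk I (T g) = (ψ₁ g : A ⧸ I) + (ψ₂ g : A ⧸ I))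
    (hψ₁ : ∀ g, ∀ x : A, Ideal.Quotient.mk I x = (ψ₁ g : A ⧸ I) →
      IsLocalRing.residue A x = χ₁ g)
    (hψ₂ : ∀ g, ∀ x : A, Ideal.Quotient.mk I x = (ψ₂ g : A ⧸ I) →
      IsLocalRing.residue A x = χ₂ g)
    (g g' : G) :
    ∃ x : A, x ∈ I ∧
      algebraMap A K x
        = (ρ g : Matrix (Fin 2) (Fin 2) K) 0 1 * (ρ g' : Matrix (Fin 2) (Fin 2) K) 1 0 := by
  have isUnit_of_residue {x y : A} (h : IsLocalRing.residue A x ≠ IsLocalRing.residue A y) :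
      IsUnit (x - y) := by
    rw [← IsLocalRing.residue_ne_zero_iff_isUnit, map_sub]
    exact sub_ne_zero.mpr h
  have hs' : (χ₁ s : IsLocalRing.ResidueField A) ≠ χ₂ s := fun h => hs (Units.ext h)
  obtain ⟨δ, hδ⟩ : IsUnit ((lam₁ : A) - lam₂) :=
    isUnit_of_residue (by rwa [hlam₁, hlam₂])
  have inj : Function.Injective (algebraMap A K) := IsLocalization.injective K le_rfl
  have T_pow (n : ℕ) : T (s ^ n) = (lam₁ : A) ^ n + (lam₂ : A) ^ n := by
    apply inj
    rw [hT, map_pow, Units.val_pow_eq_pow_val, hρs, Matrix.diagonal_pow]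
    simp
  have power_sum (n : ℕ) : (ψ₁ s : A ⧸ I) ^ n + (ψ₂ s : A ⧸ I) ^ n
      = Ideal.Quotient.mk I lam₁ ^ n + Ideal.Quotient.mk I lam₂ ^ n := by
    have h := hTψ (s ^ n)
    rw [T_pow] at h
    simpa using h.symm
  have ψ₁_s : (ψ₁ s : A ⧸ I) = Ideal.Quotient.mk I lam₁ := by
    obtain ⟨x, hx⟩ := Ideal.Quotient.mk_surjective (ψ₁ s : A ⧸ I)
    refine eq_of_power_sums_eq (by simpa using power_sum 1) (power_sum 2) (power_sum 3) ?_ ?_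
    · rw [← hx, ← map_sub]
      exact (isUnit_of_residue (by rwa [hψ₁ s x hx, hlam₂])).map _
    · rw [← map_sub, ← hδ]
      exact δ.isUnit.map _
  have ψ₂_s : (ψ₂ s : A ⧸ I) = Ideal.Quotient.mk I lam₂ := by
    linear_combination power_sum 1 - ψ₁_s
  obtain ⟨a, δ_mul_a⟩ : ∃ a : G → A, ∀ h, (δ : A) * a h = T (s * h) - lam₂ * T h :=
    ⟨fun h => (δ⁻¹ : Aˣ) * (T (s * h) - lam₂ * T h), fun _ => δ.mul_inv_cancel_left _⟩
  have map_a (h : G) : algebraMap A K (a h) = (ρ h : Matrix (Fin 2) (Fin 2) K) 0 0 := by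
    refine (δ.isUnit.map (algebraMap A K)).mul_left_cancel ?_
    rw [← map_mul, δ_mul_a, hδ, map_sub, map_sub, map_mul, hT, hT, map_mul, Units.val_mul, hρs]
    simp only [Matrix.trace_fin_two, Matrix.diagonal_mul, Matrix.cons_val_zero,
      Matrix.cons_val_one]
    ring
  have mk_a (h : G) : Ideal.Quotient.mk I (a h) = ψ₁ h := by
    refine (δ.isUnit.map (Ideal.Quotient.mk I)).mul_left_cancel ?_
    rw [← map_mul, δ_mul_a, hδ, map_sub, map_sub, map_mul, hTψ, hTψ, map_mul, map_mul,
      Units.val_mul, Units.val_mul, ψ₁_s, ψ₂_s]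
    ring
  refine ⟨a (g * g') - a g * a g', ?_, ?_⟩
  · rw [← Ideal.Quotient.eq_zero_iff_mem, map_sub, map_mul, mk_a, mk_a, mk_a, map_mul,
      Units.val_mul, sub_self]
  · rw [map_sub, map_mul, map_a, map_a, map_a, map_mul, Units.val_mul, Matrix.mul_apply,
      Fin.sum_univ_two]
    ring
end

section
/- For all g, g' ∈ G, one has in the quotient A-module B/IB the identity b̄(g g') = ψ₁(g)·b̄(g') + ψ₂(g')·b̄(g), where b̄(h) denotes the image of b(h) in B/IB and (A/I)^× acts on the A/I-module B/IB by multiplication. Equivalently, the map sending g to the upper-triangular matrix with diagonal entries ψ₁(g), ψ₂(g) and upper-right entry b̄(g) is a group homomorphism. -/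
/-- Two pairs with equal sums, sums of squares and sums of cubes agree as soon as `x₁ - x₂` and
`y₁ - x₂` are units; no assumption on the invertibility of `2` is needed. -/
theorem eq_of_power_sums_eq_s3 {R : Type*} [CommRing R] {x₁ x₂ y₁ y₂ : R}
    (h₁ : x₁ + x₂ = y₁ + y₂) (h₂ : x₁ ^ 2 + x₂ ^ 2 = y₁ ^ 2 + y₂ ^ 2)
    (h₃ : x₁ ^ 3 + x₂ ^ 3 = y₁ ^ 3 + y₂ ^ 3)
    (hx : IsUnit (x₁ - x₂)) (hy : IsUnit (y₁ - x₂)) : x₁ = y₁ := by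
  obtain rfl : y₂ = x₁ + x₂ - y₁ := by linear_combination -h₁
  have two_mul_prod : 2 * (x₁ * x₂ - y₁ * (x₁ + x₂ - y₁)) = 0 := by linear_combination -h₂
  have sum_mul_prod : (x₁ + x₂) * (x₁ * x₂ - y₁ * (x₁ + x₂ - y₁)) = 0 := by
    linear_combination -h₃ - (x₁ + x₂) * two_mul_prod
  have prod_eq : x₁ * x₂ - y₁ * (x₁ + x₂ - y₁) = 0 := by
    rw [← hx.mul_right_eq_zero]
    linear_combination sum_mul_prod - x₂ * two_mul_prod
  have : y₁ - x₁ = 0 := by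
    rw [← hy.mul_right_eq_zero]
    linear_combination prod_eq
  linear_combination -this

/-- In a local ring, the difference of two elements with distinct residues is a unit. -/
theorem isUnit_sub_of_residue_ne {A : Type*} [CommRing A] [IsLocalRing A] {x y : A}
    (h : IsLocalRing.residue A x ≠ IsLocalRing.residue A y) : IsUnit (x - y) := by
  rwa [← IsLocalRing.residue_ne_zero_iff_isUnit, map_sub, sub_ne_zero]

/-- If `T` is the trace of `ρ` and a sum `ψ₁ + ψ₂` of characters modulo `I`, and `ρ s` is diagonal
with eigenvalues lifting `ψ₁ s, ψ₂ s` and having unit difference, then the top-left entry of `ρ h`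
lies in `A` and lifts `ψ₁ h`. -/
theorem exists_lift_topLeft {G A K : Type*} [Group G] [CommRing A] [CommRing K] [Algebra A K]
    (ρ : G →* Matrix.GeneralLinearGroup (Fin 2) K) (T : G → A)
    (hT : ∀ g, algebraMap A K (T g) = Matrix.trace (ρ g : Matrix (Fin 2) (Fin 2) K))
    {s : G} {l₁ l₂ : A} (hl : IsUnit (l₁ - l₂))
    (hρs : (ρ s : Matrix (Fin 2) (Fin 2) K)
      = Matrix.diagonal ![algebraMap A K l₁, algebraMap A K l₂])
    {I : Ideal A} {ψ₁ ψ₂ : G →* (A ⧸ I)ˣ}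
    (hTψ : ∀ g, Ideal.Quotient.mk I (T g) = (ψ₁ g : A ⧸ I) + (ψ₂ g : A ⧸ I))
    (h₁ : Ideal.Quotient.mk I l₁ = (ψ₁ s : A ⧸ I))
    (h₂ : Ideal.Quotient.mk I l₂ = (ψ₂ s : A ⧸ I)) (h : G) :
    ∃ a : A, algebraMap A K a = (ρ h : Matrix (Fin 2) (Fin 2) K) 0 0 ∧
      Ideal.Quotient.mk I a = (ψ₁ h : A ⧸ I) := by
  obtain ⟨a, ha⟩ := hl.dvd (a := T (s * h) - l₂ * T h)
  refine ⟨a, (hl.map (algebraMap A K)).mul_left_cancel ?_,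
    (hl.map (Ideal.Quotient.mk I)).mul_left_cancel ?_⟩
  · rw [← map_mul, ← ha, map_sub, map_mul, hT, hT, map_mul, Units.val_mul, hρs, map_sub,
      Matrix.trace_fin_two, Matrix.trace_fin_two, Matrix.diagonal_mul, Matrix.diagonal_mul]
    simp
    ring
  · rw [← map_mul, ← ha, map_sub, map_mul, hTψ, hTψ, map_sub, h₁, h₂]
    simp
    ring

/-- Mazur–Wiles: in `B/IB` one has `b̄(g g') = ψ₁(g)·b̄(g') + ψ₂(g')·b̄(g)`;
equivalently `g ↦ (ψ₁(g), b̄(g); 0, ψ₂(g))` is a group homomorphism.  Here this is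
expressed in `K`: for any lifts `u₁, u₂ ∈ A` of `ψ₁(g), ψ₂(g')`, the difference
`b(g g') − u₁·b(g') − u₂·b(g)` lies in the submodule `I•B` of `K`. -/
theorem bbar_cocycle_identity
    {G : Type*} [Group G]
    {A K : Type*} [CommRing A] [IsReduced A] [IsNoetherianRing A] [IsLocalRing A]
    [HenselianLocalRing A] [CommRing K] [Algebra A K]
    [IsLocalization (nonZeroDivisors A) K]
    (ρ : G →* Matrix.GeneralLinearGroup (Fin 2) K)
    (T dt : G → A)
    (hT : ∀ g, algebraMap A K (T g) = Matrix.trace (ρ g : Matrix (Fin 2) (Fin 2) K))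
    (hdt : ∀ g, algebraMap A K (dt g) = Matrix.det (ρ g : Matrix (Fin 2) (Fin 2) K))
    (χ₁ χ₂ : G →* (IsLocalRing.ResidueField A)ˣ)
    (hχ : χ₁ ≠ χ₂)
    (hTχ : ∀ g, IsLocalRing.residue A (T g)
      = (χ₁ g : IsLocalRing.ResidueField A) + (χ₂ g : IsLocalRing.ResidueField A))
    (s : G) (hs : χ₁ s ≠ χ₂ s)
    (lam₁ lam₂ : Aˣ)
    (hlam₁ : IsLocalRing.residue A (lam₁ : A) = χ₁ s)
    (hlam₂ : IsLocalRing.residue A (lam₂ : A) = χ₂ s)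
    (hρs : (ρ s : Matrix (Fin 2) (Fin 2) K)
      = Matrix.diagonal ![algebraMap A K (lam₁ : A), algebraMap A K (lam₂ : A)])
    (I : Ideal A) (hI : I ≠ ⊤)
    (ψ₁ ψ₂ : G →* (A ⧸ I)ˣ)
    (hTψ : ∀ g, Ideal.Quotient.mk I (T g) = (ψ₁ g : A ⧸ I) + (ψ₂ g : A ⧸ I))
    (hψ₁ : ∀ g, ∀ x : A, Ideal.Quotient.mk I x = (ψ₁ g : A ⧸ I) →
      IsLocalRing.residue A x = χ₁ g)
    (hψ₂ : ∀ g, ∀ x : A, Ideal.Quotient.mk I x = (ψ₂ g : A ⧸ I) →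
      IsLocalRing.residue A x = χ₂ g)
    (g g' : G) (u₁ u₂ : A)
    (hu₁ : Ideal.Quotient.mk I u₁ = (ψ₁ g : A ⧸ I))
    (hu₂ : Ideal.Quotient.mk I u₂ = (ψ₂ g' : A ⧸ I)) :
    (ρ (g * g') : Matrix (Fin 2) (Fin 2) K) 0 1
        - algebraMap A K u₁ * (ρ g' : Matrix (Fin 2) (Fin 2) K) 0 1
        - algebraMap A K u₂ * (ρ g : Matrix (Fin 2) (Fin 2) K) 0 1
      ∈ I • Submodule.span A (Set.range fun h : G => (ρ h : Matrix (Fin 2) (Fin 2) K) 0 1) := by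
  have hinj : Function.Injective (algebraMap A K) := IsLocalization.injective K le_rfl
  have hne : IsLocalRing.residue A (lam₁ : A) ≠ IsLocalRing.residue A (lam₂ : A) := by
    rw [hlam₁, hlam₂]
    exact fun e => hs (Units.ext e)
  have hunit : IsUnit ((lam₁ : A) - lam₂) := isUnit_sub_of_residue_ne hne
  have power_sum (n : ℕ) : Ideal.Quotient.mk I (lam₁ : A) ^ n + Ideal.Quotient.mk I (lam₂ : A) ^ n
      = (ψ₁ s : A ⧸ I) ^ n + (ψ₂ s : A ⧸ I) ^ n := by
    have hTn : T (s ^ n) = (lam₁ : A) ^ n + (lam₂ : A) ^ n := by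
      apply hinj
      rw [hT, map_pow, Units.val_pow_eq_pow_val, hρs, Matrix.diagonal_pow, Matrix.trace_fin_two]
      simp
    simpa [hTn] using hTψ (s ^ n)
  have sum_eq : Ideal.Quotient.mk I (lam₁ : A) + Ideal.Quotient.mk I (lam₂ : A)
      = (ψ₁ s : A ⧸ I) + (ψ₂ s : A ⧸ I) := by simpa using power_sum 1
  have lam₁_lifts : Ideal.Quotient.mk I (lam₁ : A) = (ψ₁ s : A ⧸ I) := by
    obtain ⟨v, hv⟩ := Ideal.Quotient.mk_surjective (ψ₁ s : A ⧸ I)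
    refine eq_of_power_sums_eq_s3 sum_eq (power_sum 2) (power_sum 3) ?_ ?_
    · simpa using hunit.map (Ideal.Quotient.mk I)
    · rw [← hv, ← map_sub]
      refine (isUnit_sub_of_residue_ne ?_).map (Ideal.Quotient.mk I)
      rwa [hψ₁ s v hv, ← hlam₁]
  have lam₂_lifts : Ideal.Quotient.mk I (lam₂ : A) = (ψ₂ s : A ⧸ I) := by
    rwa [lam₁_lifts, add_right_inj] at sum_eq
  have lift_topLeft := exists_lift_topLeft ρ T hT hunit hρs hTψ lam₁_lifts lam₂_lifts
  obtain ⟨a, ha, haψ⟩ := lift_topLeft g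
  obtain ⟨a', ha', haψ'⟩ := lift_topLeft g'
  have hd : algebraMap A K (T g' - a') = (ρ g' : Matrix (Fin 2) (Fin 2) K) 1 1 := by
    rw [map_sub, hT, ha', Matrix.trace_fin_two, add_sub_cancel_left]
  have mem_a : a - u₁ ∈ I := Ideal.Quotient.eq.mp (haψ.trans hu₁.symm)
  have mem_d : T g' - a' - u₂ ∈ I := by
    refine Ideal.Quotient.eq.mp ?_
    rw [map_sub, hTψ, haψ', hu₂, add_sub_cancel_left]
  have decomposition : (ρ (g * g') : Matrix (Fin 2) (Fin 2) K) 0 1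
        - algebraMap A K u₁ * (ρ g' : Matrix (Fin 2) (Fin 2) K) 0 1
        - algebraMap A K u₂ * (ρ g : Matrix (Fin 2) (Fin 2) K) 0 1
      = (a - u₁) • (ρ g' : Matrix (Fin 2) (Fin 2) K) 0 1
        + (T g' - a' - u₂) • (ρ g : Matrix (Fin 2) (Fin 2) K) 0 1 := by
    rw [map_mul, Units.val_mul, Matrix.mul_apply, Fin.sum_univ_two, Algebra.smul_def,
      Algebra.smul_def, map_sub, map_sub _ (T g' - a'), ha, hd]
    ring
  rw [decomposition]
  exact add_mem (Submodule.smul_mem_smul mem_a (Submodule.subset_span ⟨g', rfl⟩))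
    (Submodule.smul_mem_smul mem_d (Submodule.subset_span ⟨g, rfl⟩))
end

section
/- Let H := {g ∈ G : ψ₁(g) = ψ₂(g)} be the kernel of the character ψ₁ψ₂⁻¹. Then the images of the elements b(h), h ∈ H, generate B/IB as an A-module. -/
/-- If `ρ s = diag(x, y)`, the top-right entry of `ρ (s * g * s⁻¹ * g⁻¹)` is
`(x - y) y⁻¹ (det ρ g)⁻¹ a(g) b(g)`; this is stated without inverses. -/
theorem commutator_upper_right_of_diagonal {G K : Type*} [Group G] [CommRing K]
    (ρ : G →* Matrix.GeneralLinearGroup (Fin 2) K) {s : G} {x y : K}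
    (hρs : (ρ s : Matrix (Fin 2) (Fin 2) K) = Matrix.diagonal ![x, y]) (g : G) :
    x * y * (ρ g : Matrix (Fin 2) (Fin 2) K).det * (ρ (s * g * s⁻¹ * g⁻¹) : Matrix (Fin 2) (Fin 2) K) 0 1
      = x * (x - y) * (ρ g : Matrix (Fin 2) (Fin 2) K) 0 0
        * (ρ g : Matrix (Fin 2) (Fin 2) K) 0 1 := by
  have hmul : (ρ (s * g * s⁻¹ * g⁻¹) : Matrix (Fin 2) (Fin 2) K) * ((ρ g : Matrix (Fin 2) (Fin 2) K) * ρ s)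
      = (ρ s : Matrix (Fin 2) (Fin 2) K) * ρ g := by
    simp only [← Units.val_mul, ← map_mul]
    congr 2
    simp [mul_assoc]
  rw [hρs] at hmul
  have h₀ := congrFun₂ hmul 0 0
  have h₁ := congrFun₂ hmul 0 1
  simp only [Matrix.mul_apply (M := (ρ (s * g * s⁻¹ * g⁻¹) : Matrix (Fin 2) (Fin 2) K)), Fin.sum_univ_two,
    Matrix.mul_diagonal, Matrix.diagonal_mul, Matrix.cons_val_zero, Matrix.cons_val_one] at h₀ h₁
  rw [Matrix.det_fin_two]
  linear_combination x * (ρ g : Matrix (Fin 2) (Fin 2) K) 0 0 * h₁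
    - y * (ρ g : Matrix (Fin 2) (Fin 2) K) 0 1 * h₀

/-- Mazur–Wiles: with `H := ker (ψ₁ψ₂⁻¹) = {g | ψ₁ g = ψ₂ g}`, the images of the
`b(h)`, `h ∈ H`, generate `B/IB` as an `A`-module; i.e. `B = span (b '' H) ⊔ I•B`. -/
theorem bH_generates_B_mod_IB
    {G : Type*} [Group G]
    {A K : Type*} [CommRing A] [IsReduced A] [IsNoetherianRing A] [IsLocalRing A]
    [HenselianLocalRing A] [CommRing K] [Algebra A K]
    [IsLocalization (nonZeroDivisors A) K]
    (ρ : G →* Matrix.GeneralLinearGroup (Fin 2) K)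
    (T dt : G → A)
    (hT : ∀ g, algebraMap A K (T g) = Matrix.trace (ρ g : Matrix (Fin 2) (Fin 2) K))
    (hdt : ∀ g, algebraMap A K (dt g) = Matrix.det (ρ g : Matrix (Fin 2) (Fin 2) K))
    (χ₁ χ₂ : G →* (IsLocalRing.ResidueField A)ˣ)
    (hχ : χ₁ ≠ χ₂)
    (hTχ : ∀ g, IsLocalRing.residue A (T g)
      = (χ₁ g : IsLocalRing.ResidueField A) + (χ₂ g : IsLocalRing.ResidueField A))
    (s : G) (hs : χ₁ s ≠ χ₂ s)
    (lam₁ lam₂ : Aˣ)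
    (hlam₁ : IsLocalRing.residue A (lam₁ : A) = χ₁ s)
    (hlam₂ : IsLocalRing.residue A (lam₂ : A) = χ₂ s)
    (hρs : (ρ s : Matrix (Fin 2) (Fin 2) K)
      = Matrix.diagonal ![algebraMap A K (lam₁ : A), algebraMap A K (lam₂ : A)])
    (I : Ideal A) (hI : I ≠ ⊤)
    (ψ₁ ψ₂ : G →* (A ⧸ I)ˣ)
    (hTψ : ∀ g, Ideal.Quotient.mk I (T g) = (ψ₁ g : A ⧸ I) + (ψ₂ g : A ⧸ I))
    (hψ₁ : ∀ g, ∀ x : A, Ideal.Quotient.mk I x = (ψ₁ g : A ⧸ I) →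
      IsLocalRing.residue A x = χ₁ g)
    (hψ₂ : ∀ g, ∀ x : A, Ideal.Quotient.mk I x = (ψ₂ g : A ⧸ I) →
      IsLocalRing.residue A x = χ₂ g)
    :
    Submodule.span A (Set.range fun h : G => (ρ h : Matrix (Fin 2) (Fin 2) K) 0 1)
      = Submodule.span A
          ((fun h : G => (ρ h : Matrix (Fin 2) (Fin 2) K) 0 1) '' {h : G | ψ₁ h = ψ₂ h})
        ⊔ I • Submodule.span A (Set.range fun h : G => (ρ h : Matrix (Fin 2) (Fin 2) K) 0 1) := by
  refine le_antisymm (Submodule.span_le.mpr ?_)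
    (sup_le (Submodule.span_mono (Set.image_subset_range _ _)) Submodule.smul_le_right)
  rintro _ ⟨g, rfl⟩
  refine Submodule.mem_sup_left ?_
  have hmem : ψ₁ (s * g * s⁻¹ * g⁻¹) = ψ₂ (s * g * s⁻¹ * g⁻¹) := by
    simp only [map_mul, map_inv, mul_inv_cancel_comm, mul_inv_cancel]
  have hunit : IsUnit ((lam₁ : A) * (T (s * g) - lam₂ * T g)) := by
    refine lam₁.isUnit.mul ?_
    rw [← IsLocalRing.residue_ne_zero_iff_isUnit]
    have hres : IsLocalRing.residue A (T (s * g) - lam₂ * T g)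
        = (χ₁ g : IsLocalRing.ResidueField A) * (χ₁ s - χ₂ s) := by
      simp only [map_sub, map_mul, hTχ, hlam₂, Units.val_mul]
      ring
    rw [hres]
    exact mul_ne_zero (Units.ne_zero _) (sub_ne_zero.mpr fun h => hs (Units.ext h))
  have htrace : algebraMap A K (T (s * g) - lam₂ * T g)
      = (algebraMap A K lam₁ - algebraMap A K lam₂) * (ρ g : Matrix (Fin 2) (Fin 2) K) 0 0 := by
    simp only [map_sub, map_mul, hT, Units.val_mul, hρs, Matrix.trace_fin_two,
      Matrix.diagonal_mul, Matrix.cons_val_zero, Matrix.cons_val_one]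
    ring
  have hb : algebraMap A K (lam₁ * (T (s * g) - lam₂ * T g))
        * (ρ g : Matrix (Fin 2) (Fin 2) K) 0 1
      = algebraMap A K (lam₁ * lam₂ * dt g) * (ρ (s * g * s⁻¹ * g⁻¹) : Matrix (Fin 2) (Fin 2) K) 0 1 := by
    have h := commutator_upper_right_of_diagonal ρ hρs g
    rw [map_mul, htrace, map_mul, map_mul, hdt]
    linear_combination -h
  obtain ⟨u, hu⟩ := hunit
  have hsmul : (ρ g : Matrix (Fin 2) (Fin 2) K) 0 1
      = ((↑u⁻¹ : A) * (lam₁ * lam₂ * dt g)) •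
        (ρ (s * g * s⁻¹ * g⁻¹) : Matrix (Fin 2) (Fin 2) K) 0 1 := by
    rw [mul_smul, Algebra.smul_def (lam₁ * lam₂ * dt g : A), ← hb, ← hu, ← Algebra.smul_def,
      smul_smul, Units.inv_mul, one_smul]
  change (ρ g : Matrix (Fin 2) (Fin 2) K) 0 1 ∈ _
  rw [hsmul]
  exact Submodule.smul_mem _ _ (Submodule.subset_span ⟨_, hmem, rfl⟩)
end

section
/- For every g ∈ G, one has in B/IB the identity b̄(s g s⁻¹ g⁻¹) = ψ₂(g)⁻¹·(λ̄₁ λ̄₂⁻¹ − 1)·b̄(g), where b̄(h) denotes the image of b(h) in B/IB and λ̄ᵢ ∈ (A/I)^× denotes the image of the unit λᵢ. -/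
/-- Two pairs with equal power sums in degrees one, two and three agree, provided that the
relevant differences are units. -/
theorem eq_and_eq_of_power_sums {R : Type*} [CommRing R] {x y p q : R}
    (h1 : x + y = p + q) (h2 : x ^ 2 + y ^ 2 = p ^ 2 + q ^ 2) (h3 : x ^ 3 + y ^ 3 = p ^ 3 + q ^ 3)
    (hpq : IsUnit (p - q)) (hxq : IsUnit (x - q)) : x = p ∧ y = q := by
  have hy : y = p + q - x := by linear_combination h1
  subst hy
  have hprod : (p - q) * (x * (p + q - x) - p * q) = 0 := by
    linear_combination (p + 2 * q) * h2 - h3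
  have hδ := (hpq.mul_right_eq_zero).1 hprod
  have hx : (x - q) * (x - p) = 0 := by linear_combination -hδ
  have := (hxq.mul_right_eq_zero).1 hx
  exact ⟨by linear_combination this, by linear_combination -this⟩

/-- The lower-right entry of a two by two matrix is determined by its trace and the trace of its
product with a diagonal matrix. -/
theorem sub_mul_lower_right_eq {R : Type*} [CommRing R] (p q : R) (N : Matrix (Fin 2) (Fin 2) R) :
    (p - q) * N 1 1 = p * N.trace - (Matrix.diagonal ![p, q] * N).trace := by
  simp only [Matrix.trace_fin_two, Matrix.diagonal_mul, Matrix.cons_val_zero, Matrix.cons_val_one]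
  ring

/-- The upper-right entry of the commutator of a diagonal matrix with another matrix. -/
theorem diagonal_commutator_upper_right {R : Type*} [CommRing R] {p q q' : R} (hq : q * q' = 1)
    {S' M N : Matrix (Fin 2) (Fin 2) R} (hS : Matrix.diagonal ![p, q] * S' = 1)
    (hS' : S' * Matrix.diagonal ![p, q] = 1) (hMN : M * N = 1) :
    (Matrix.diagonal ![p, q] * M * S' * N) 0 1 = N 1 1 * (p * q' - 1) * M 0 1 := by
  have e00 := congrFun (congrFun hS 0) 0
  have e10 := congrFun (congrFun hS 1) 0
  have e01 := congrFun (congrFun hS' 0) 1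
  have e11 := congrFun (congrFun hS 1) 1
  have m01 := congrFun (congrFun hMN 0) 1
  simp only [Matrix.one_apply_eq, Matrix.one_apply, Matrix.mul_apply, Fin.sum_univ_two]
    at e00 e10 e01 e11 m01
  norm_num at e00 e10 e01 e11 m01
  have s10 : S' 1 0 = 0 := by linear_combination q' * e10 - S' 1 0 * hq
  have s01 : S' 0 1 = 0 := by linear_combination q' * e01 - S' 0 1 * hq
  have s11 : S' 1 1 = q' := by linear_combination q' * e11 - S' 1 1 * hq
  simp only [Matrix.mul_apply, Fin.sum_univ_two, Matrix.diagonal_apply_eq, s10, s01, s11]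
  norm_num
  linear_combination (M 0 0 * N 0 1) * e00 + m01

/-- Mazur–Wiles: in `B/IB` one has
`b̄(s g s⁻¹ g⁻¹) = ψ₂(g)⁻¹·(λ̄₁λ̄₂⁻¹ − 1)·b̄(g)`, expressed in `K` via any lift
`u ∈ A` of the coefficient `ψ₂(g)⁻¹·(λ̄₁λ̄₂⁻¹ − 1)`. -/
theorem bbar_commutator_identity
    {G : Type*} [Group G]
    {A K : Type*} [CommRing A] [IsReduced A] [IsNoetherianRing A] [IsLocalRing A]
    [HenselianLocalRing A] [CommRing K] [Algebra A K]
    [IsLocalization (nonZeroDivisors A) K]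
    (ρ : G →* Matrix.GeneralLinearGroup (Fin 2) K)
    (T dt : G → A)
    (hT : ∀ g, algebraMap A K (T g) = Matrix.trace (ρ g : Matrix (Fin 2) (Fin 2) K))
    (hdt : ∀ g, algebraMap A K (dt g) = Matrix.det (ρ g : Matrix (Fin 2) (Fin 2) K))
    (χ₁ χ₂ : G →* (IsLocalRing.ResidueField A)ˣ)
    (hχ : χ₁ ≠ χ₂)
    (hTχ : ∀ g, IsLocalRing.residue A (T g)
      = (χ₁ g : IsLocalRing.ResidueField A) + (χ₂ g : IsLocalRing.ResidueField A))
    (s : G) (hs : χ₁ s ≠ χ₂ s)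
    (lam₁ lam₂ : Aˣ)
    (hlam₁ : IsLocalRing.residue A (lam₁ : A) = χ₁ s)
    (hlam₂ : IsLocalRing.residue A (lam₂ : A) = χ₂ s)
    (hρs : (ρ s : Matrix (Fin 2) (Fin 2) K)
      = Matrix.diagonal ![algebraMap A K (lam₁ : A), algebraMap A K (lam₂ : A)])
    (I : Ideal A) (hI : I ≠ ⊤)
    (ψ₁ ψ₂ : G →* (A ⧸ I)ˣ)
    (hTψ : ∀ g, Ideal.Quotient.mk I (T g) = (ψ₁ g : A ⧸ I) + (ψ₂ g : A ⧸ I))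
    (hψ₁ : ∀ g, ∀ x : A, Ideal.Quotient.mk I x = (ψ₁ g : A ⧸ I) →
      IsLocalRing.residue A x = χ₁ g)
    (hψ₂ : ∀ g, ∀ x : A, Ideal.Quotient.mk I x = (ψ₂ g : A ⧸ I) →
      IsLocalRing.residue A x = χ₂ g)
    (g : G) (u : A)
    (hu : Ideal.Quotient.mk I u
      = (((ψ₂ g)⁻¹ : (A ⧸ I)ˣ) : A ⧸ I) *
          (((Units.map (Ideal.Quotient.mk I).toMonoidHom lam₁
              * (Units.map (Ideal.Quotient.mk I).toMonoidHom lam₂)⁻¹ : (A ⧸ I)ˣ) : A ⧸ I) - 1)) :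
    (ρ (s * g * s⁻¹ * g⁻¹) : Matrix (Fin 2) (Fin 2) K) 0 1
        - algebraMap A K u * (ρ g : Matrix (Fin 2) (Fin 2) K) 0 1
      ∈ I • Submodule.span A (Set.range fun h : G => (ρ h : Matrix (Fin 2) (Fin 2) K) 0 1) := by
  classical
  have hinj : Function.Injective (algebraMap A K) :=
    IsLocalization.injective K (le_refl (nonZeroDivisors A))
  have hTs : ∀ n : ℕ, T (s ^ n) = (lam₁ : A) ^ n + (lam₂ : A) ^ n := by
    intro n
    apply hinj
    rw [hT, map_pow, Units.val_pow_eq_pow_val, hρs, Matrix.diagonal_pow, Matrix.trace_diagonal]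
    simp [Fin.sum_univ_two]
  have hunit : ∀ x : A, IsLocalRing.residue A x = χ₁ s → IsUnit (x - lam₂) := by
    intro x hx
    rw [← IsLocalRing.residue_ne_zero_iff_isUnit, map_sub, hx, hlam₂, sub_ne_zero]
    exact fun h => hs (Units.ext h)
  have hlam : IsUnit ((lam₁ : A) - lam₂) := hunit _ hlam₁
  have hψsum : ∀ n : ℕ, (ψ₁ s : A ⧸ I) ^ n + (ψ₂ s : A ⧸ I) ^ n
      = Ideal.Quotient.mk I lam₁ ^ n + Ideal.Quotient.mk I lam₂ ^ n := by
    intro n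
    have := hTψ (s ^ n)
    rw [hTs] at this
    simpa using this.symm
  obtain ⟨hψ₁s, hψ₂s⟩ : (ψ₁ s : A ⧸ I) = Ideal.Quotient.mk I lam₁ ∧
      (ψ₂ s : A ⧸ I) = Ideal.Quotient.mk I lam₂ := by
    refine eq_and_eq_of_power_sums (by simpa using hψsum 1) (hψsum 2) (hψsum 3) ?_ ?_
    · simpa using hlam.map (Ideal.Quotient.mk I)
    · obtain ⟨x, hx⟩ := Ideal.Quotient.mk_surjective (ψ₁ s : A ⧸ I)
      simpa [hx] using (hunit x (hψ₁ s x hx)).map (Ideal.Quotient.mk I)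
  obtain ⟨v, hv⟩ := hlam
  obtain ⟨D, hD⟩ : ∃ D : A, ((lam₁ : A) - lam₂) * D = lam₁ * T g⁻¹ - T (s * g⁻¹) :=
    ⟨((v⁻¹ : Aˣ) : A) * (lam₁ * T g⁻¹ - T (s * g⁻¹)), by rw [← hv, Units.mul_inv_cancel_left]⟩
  have hDK : algebraMap A K D = (ρ g⁻¹ : Matrix (Fin 2) (Fin 2) K) 1 1 := by
    apply (v.isUnit.map (algebraMap A K)).mul_left_cancel
    rw [hv, ← map_mul, hD, map_sub (algebraMap A K) (lam₁ : A), sub_mul_lower_right_eq,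
      map_sub, map_mul, hT, hT, map_mul, Units.val_mul, hρs]
  have hDI : Ideal.Quotient.mk I D = (((ψ₂ g)⁻¹ : (A ⧸ I)ˣ) : A ⧸ I) := by
    apply (v.isUnit.map (Ideal.Quotient.mk I)).mul_left_cancel
    rw [hv, ← map_mul, hD, map_sub, map_mul, hTψ, hTψ, map_mul, map_mul, Units.val_mul,
      Units.val_mul, hψ₁s, hψ₂s, ← map_inv ψ₂, map_sub]
    ring
  have hcomm : (ρ (s * g * s⁻¹ * g⁻¹) : Matrix (Fin 2) (Fin 2) K) 0 1
      = algebraMap A K (D * (lam₁ * ((lam₂⁻¹ : Aˣ) : A) - 1))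
        * (ρ g : Matrix (Fin 2) (Fin 2) K) 0 1 := by
    have hval : ∀ x y : G, x * y = 1 → (ρ x : Matrix (Fin 2) (Fin 2) K) * ρ y = 1 := by
      intro x y h
      rw [← Units.val_mul, ← map_mul, h, map_one, Units.val_one]
    have hS := hval s s⁻¹ (mul_inv_cancel s)
    have hS' := hval s⁻¹ s (inv_mul_cancel s)
    rw [hρs] at hS hS'
    have hq : algebraMap A K lam₂ * algebraMap A K ((lam₂⁻¹ : Aˣ) : A) = 1 := by
      rw [← map_mul, Units.mul_inv, map_one]
    simp only [map_mul ρ, Units.val_mul, hρs]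
    rw [diagonal_commutator_upper_right hq hS hS' (hval g g⁻¹ (mul_inv_cancel g))]
    simp only [map_mul, map_sub, map_one, hDK]
  rw [hcomm, ← sub_mul, ← map_sub, ← Algebra.smul_def]
  refine Submodule.smul_mem_smul ?_ (Submodule.subset_span ⟨g, rfl⟩)
  rw [← Ideal.Quotient.eq_zero_iff_mem, map_sub, hu, map_mul, hDI, map_sub, map_mul, map_one,
    Units.val_mul]
  exact sub_self _
end

section
/- Let f : B → A/I be an A-linear map and suppose there exists x ∈ A/I such that f(b(g)) = (ψ₁(g) − ψ₂(g))·x for all g ∈ G (i.e. the 1-cocycle g ↦ f(b(g))·ψ₂(g)⁻¹ for the character ψ₁ψ₂⁻¹ is a coboundary, equivalently the extension of ψ₂ by ψ₁ with matrix (ψ₁, f∘b; 0, ψ₂) splits). Then f = 0. In other words, the natural A-linear map 𝔧 : Hom_A(B, A/I) → Ext¹_{(A/I)[G]}(ψ₂, ψ₁) is injective. -/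
/-- Mazur–Wiles: the map `𝔧 : Hom_A(B, A/I) → Ext¹_{(A/I)[G]}(ψ₂, ψ₁)` is injective:
if `f : B → A/I` is `A`-linear and the cocycle `g ↦ f(b(g))` is a coboundary, i.e.
`f(b(g)) = (ψ₁(g) − ψ₂(g))·x` for some `x` and all `g`, then `f = 0`. -/
theorem j_injective
    {G : Type*} [Group G]
    {A K : Type*} [CommRing A] [IsReduced A] [IsNoetherianRing A] [IsLocalRing A]
    [HenselianLocalRing A] [CommRing K] [Algebra A K]
    [IsLocalization (nonZeroDivisors A) K]
    (ρ : G →* Matrix.GeneralLinearGroup (Fin 2) K)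
    (T dt : G → A)
    (hT : ∀ g, algebraMap A K (T g) = Matrix.trace (ρ g : Matrix (Fin 2) (Fin 2) K))
    (hdt : ∀ g, algebraMap A K (dt g) = Matrix.det (ρ g : Matrix (Fin 2) (Fin 2) K))
    (χ₁ χ₂ : G →* (IsLocalRing.ResidueField A)ˣ)
    (hχ : χ₁ ≠ χ₂)
    (hTχ : ∀ g, IsLocalRing.residue A (T g)
      = (χ₁ g : IsLocalRing.ResidueField A) + (χ₂ g : IsLocalRing.ResidueField A))
    (s : G) (hs : χ₁ s ≠ χ₂ s)
    (lam₁ lam₂ : Aˣ)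
    (hlam₁ : IsLocalRing.residue A (lam₁ : A) = χ₁ s)
    (hlam₂ : IsLocalRing.residue A (lam₂ : A) = χ₂ s)
    (hρs : (ρ s : Matrix (Fin 2) (Fin 2) K)
      = Matrix.diagonal ![algebraMap A K (lam₁ : A), algebraMap A K (lam₂ : A)])
    (I : Ideal A) (hI : I ≠ ⊤)
    (ψ₁ ψ₂ : G →* (A ⧸ I)ˣ)
    (hTψ : ∀ g, Ideal.Quotient.mk I (T g) = (ψ₁ g : A ⧸ I) + (ψ₂ g : A ⧸ I))
    (hψ₁ : ∀ g, ∀ x : A, Ideal.Quotient.mk I x = (ψ₁ g : A ⧸ I) →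
      IsLocalRing.residue A x = χ₁ g)
    (hψ₂ : ∀ g, ∀ x : A, Ideal.Quotient.mk I x = (ψ₂ g : A ⧸ I) →
      IsLocalRing.residue A x = χ₂ g)
    (f : ↥(Submodule.span A (Set.range fun h : G => (ρ h : Matrix (Fin 2) (Fin 2) K) 0 1))
      →ₗ[A] A ⧸ I)
    (hcob : ∃ x : A ⧸ I, ∀ g : G,
      f ⟨(ρ g : Matrix (Fin 2) (Fin 2) K) 0 1, Submodule.subset_span (Set.mem_range_self g)⟩
        = ((ψ₁ g : A ⧸ I) - (ψ₂ g : A ⧸ I)) * x) :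
    f = 0 := by
  obtain ⟨x, hx⟩ := hcob
  obtain ⟨u₁, hu₁⟩ := Ideal.Quotient.mk_surjective (ψ₁ s : A ⧸ I)
  obtain ⟨u₂, hu₂⟩ := Ideal.Quotient.mk_surjective (ψ₂ s : A ⧸ I)
  have hunit : IsUnit (u₁ - u₂) := by
    rw [← IsLocalRing.residue_ne_zero_iff_isUnit, map_sub, hψ₁ s u₁ hu₁, hψ₂ s u₂ hu₂,
      sub_ne_zero]
    exact fun h => hs (Units.ext h)
  have hψs : IsUnit ((ψ₁ s : A ⧸ I) - (ψ₂ s : A ⧸ I)) := by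
    simpa only [map_sub, hu₁, hu₂] using hunit.map (Ideal.Quotient.mk I)
  have hbs : (⟨(ρ s : Matrix (Fin 2) (Fin 2) K) 0 1,
      Submodule.subset_span (Set.mem_range_self s)⟩ :
      Submodule.span A (Set.range fun h : G => (ρ h : Matrix (Fin 2) (Fin 2) K) 0 1)) = 0 :=
    Subtype.ext (by simp [hρs])
  have hx0 : x = 0 := by
    have h := hx s
    rw [hbs, map_zero] at h
    exact hψs.mul_right_eq_zero.mp h.symm
  refine LinearMap.ext_on_range (Submodule.span_range_subtype_eq_top_iff _ (fun g =>
    Submodule.subset_span (Set.mem_range_self g)) |>.mpr rfl) fun g => ?_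
  rw [hx g, hx0, mul_zero, LinearMap.zero_apply]
end

section
/- Let K be a field of characteristic zero, A ⊆ K a Noetherian subring, G a group, and ρ : G → GL₂(K) a group homomorphism such that K² is a semisimple module over the group algebra K[G] (acting through ρ) and tr ρ(g) ∈ A for all g ∈ G. Then the A-subalgebra A[ρ(G)] of the matrix algebra M₂(K) generated by the matrices ρ(g), g ∈ G, is a finitely generated A-module. -/
set_option synthInstance.maxHeartbeats 1000000

/-- The representation of `G` on `Fin 2 → R` associated to a homomorphism
`ρ : G →* GL₂(R)`. -/
noncomputable def glRep {R : Type*} [CommRing R] {G : Type*} [Group G]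
    (ρ : G →* Matrix.GeneralLinearGroup (Fin 2) R) :
    Representation R G (Fin 2 → R) :=
  (Matrix.toLinAlgEquiv' (R := R) (n := Fin 2)).toAlgHom.toRingHom.toMonoidHom.comp
    ((Units.coeHom (Matrix (Fin 2) (Fin 2) R)).comp ρ)

/-- An invariant subspace of a semisimple representation has an invariant complement. -/
theorem Representation.exists_isCompl_invtSubmodule {k G V : Type*} [Field k] [Group G]
    [AddCommGroup V] [Module k V] (σ : Representation k G V)
    (hss : IsSemisimpleModule (MonoidAlgebra k G) σ.asModule)
    {p : Submodule k V} (hp : ∀ g, ∀ v ∈ p, σ g v ∈ p) :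
    ∃ q : Submodule k V, (∀ g, ∀ v ∈ q, σ g v ∈ q) ∧ IsCompl p q := by
  have hc : ComplementedLattice σ.invtSubmodule :=
    σ.mapSubmodule.complementedLattice_iff.mpr hss.toComplementedLattice
  obtain ⟨q, hq⟩ := hc.exists_isCompl ⟨p, σ.mem_invtSubmodule.mpr hp⟩
  refine ⟨q, σ.mem_invtSubmodule.mp q.2, ?_, ?_⟩
  · rw [disjoint_iff]
    exact congrArg Subtype.val hq.disjoint.eq_bot
  · rw [codisjoint_iff]
    exact congrArg Subtype.val hq.codisjoint.eq_top

namespace Matrix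

variable {K : Type*} [Field K] [CharZero K]

/-- Two nilpotent `2 × 2` matrices that are orthogonal for the trace form have product zero. -/
theorem mul_eq_zero_of_trace_eq_zero_fin_two {x y : Matrix (Fin 2) (Fin 2) K}
    (hx : x.trace = 0) (hxx : (x * x).trace = 0) (hy : y.trace = 0) (hyy : (y * y).trace = 0)
    (hxy : (x * y).trace = 0) : x * y = 0 := by
  simp only [trace_fin_two, mul_apply, Fin.sum_univ_two] at hx hxx hy hyy hxy
  have h2 : (2 : K) ≠ 0 := two_ne_zero
  have hx' : x 1 1 = - x 0 0 := by linear_combination hx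
  have hy' : y 1 1 = - y 0 0 := by linear_combination hy
  rw [hx'] at hxx hxy
  rw [hy'] at hyy hxy
  have ex : x 0 0 ^ 2 + x 0 1 * x 1 0 = 0 := by
    apply mul_left_cancel₀ h2; linear_combination hxx
  have ey : y 0 0 ^ 2 + y 0 1 * y 1 0 = 0 := by
    apply mul_left_cancel₀ h2; linear_combination hyy
  ext i j
  apply pow_eq_zero_iff two_ne_zero |>.mp
  fin_cases i <;> fin_cases j <;>
    simp only [mul_apply, Fin.sum_univ_two, Fin.zero_eta, Fin.mk_one, hx', hy']
  · linear_combination y 0 0 ^ 2 * ex - x 0 1 * x 1 0 * ey + x 0 1 * y 1 0 * hxy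
  · linear_combination y 0 1 ^ 2 * ex + x 0 1 ^ 2 * ey - x 0 1 * y 0 1 * hxy
  · linear_combination y 1 0 ^ 2 * ex + x 1 0 ^ 2 * ey - x 1 0 * y 1 0 * hxy
  · linear_combination y 0 0 ^ 2 * ex - x 0 1 * x 1 0 * ey + x 1 0 * y 0 1 * hxy

/-- If every subspace of `K²` stable under a subalgebra `S` of `M₂(K)` has a stable complement,
then the trace form of `S` is nondegenerate. -/
theorem eq_zero_of_forall_trace_mul_eq_zero (S : Subalgebra K (Matrix (Fin 2) (Fin 2) K))
    (hS : ∀ p : Submodule K (Fin 2 → K), (∀ s ∈ S, ∀ v ∈ p, s *ᵥ v ∈ p) →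
      ∃ q : Submodule K (Fin 2 → K), (∀ s ∈ S, ∀ v ∈ q, s *ᵥ v ∈ q) ∧ IsCompl p q)
    {x : Matrix (Fin 2) (Fin 2) K} (hx : x ∈ S) (htr : ∀ y ∈ S, (x * y).trace = 0) : x = 0 := by
  let p : Submodule K (Fin 2 → K) :=
    { carrier := {v | ∀ y ∈ S, (x * y) *ᵥ v = 0}
      add_mem' := fun ha hb y hy => by rw [mulVec_add, ha y hy, hb y hy, add_zero]
      zero_mem' := fun y _ => mulVec_zero _
      smul_mem' := fun c v hv y hy => by rw [mulVec_smul, hv y hy, smul_zero] }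
  have hp : ∀ s ∈ S, ∀ v ∈ p, s *ᵥ v ∈ p := fun s hs v hv y hy => by
    rw [mulVec_mulVec, mul_assoc]
    exact hv _ (S.mul_mem hy hs)
  have hxp : ∀ v, x *ᵥ v ∈ p := fun v y hy => by
    have hzero : x * (y * x) = 0 := by
      apply mul_eq_zero_of_trace_eq_zero_fin_two
      · simpa using htr 1 S.one_mem
      · exact htr x hx
      · rw [trace_mul_comm]
        exact htr y hy
      · rw [mul_assoc, trace_mul_comm, mul_assoc, mul_assoc]
        exact htr _ (S.mul_mem hy (S.mul_mem hx hy))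
      · exact htr _ (S.mul_mem hy hx)
    rw [mulVec_mulVec, mul_assoc, hzero, zero_mulVec]
  obtain ⟨q, hq, hpq⟩ := hS p hp
  refine toLin'.injective (LinearMap.ext fun v => ?_)
  obtain ⟨v₁, hv₁, v₂, hv₂, rfl⟩ : ∃ v₁ ∈ p, ∃ v₂ ∈ q, v₁ + v₂ = v :=
    Submodule.mem_sup.mp (hpq.sup_eq_top ▸ Submodule.mem_top)
  have h₁ : x *ᵥ v₁ = 0 := by simpa using hv₁ 1 S.one_mem
  have h₂ : x *ᵥ v₂ = 0 := Submodule.disjoint_def.mp hpq.disjoint _ (hxp v₂) (hq x hx v₂ hv₂)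
  rw [toLin'_apply, mulVec_add, h₁, h₂, add_zero, map_zero, LinearMap.zero_apply]

end Matrix

/-- The algebra generated by the image of a monoid is spanned by that image. -/
theorem Algebra.adjoin_range_monoidHom_eq_span (R : Type*) {B M : Type*} [CommSemiring R]
    [Semiring B] [Algebra R B] [Monoid M] (f : M →* B) :
    Subalgebra.toSubmodule (Algebra.adjoin R (Set.range f)) = Submodule.span R (Set.range f) := by
  rw [Algebra.adjoin_eq_span, ← MonoidHom.coe_mrange, Submonoid.closure_eq]

/-- If `K` is a field of characteristic zero, `A ⊆ K` a Noetherian subring, and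
`ρ : G → GL₂(K)` is semisimple (i.e. `K²` is a semisimple `K[G]`-module) with all traces
in `A`, then the `A`-subalgebra `A[ρ(G)]` of `M₂(K)` is a finitely generated `A`-module. -/
theorem adjoin_image_finite_of_semisimple_of_trace_mem
    {K : Type*} [Field K] [CharZero K] (A : Subring K) [IsNoetherianRing A]
    {G : Type*} [Group G] (ρ : G →* Matrix.GeneralLinearGroup (Fin 2) K)
    (htr : ∀ g : G, Matrix.trace (ρ g : Matrix (Fin 2) (Fin 2) K) ∈ A)
    (hss : IsSemisimpleModule (MonoidAlgebra K G) (glRep ρ).asModule) :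
    (Subalgebra.toSubmodule
      (Algebra.adjoin A (Set.range fun g : G => (ρ g : Matrix (Fin 2) (Fin 2) K)))).FG := by
  let f : G →* Matrix (Fin 2) (Fin 2) K := (Units.coeHom _).comp ρ
  change (Subalgebra.toSubmodule (Algebra.adjoin A (Set.range f))).FG
  replace htr : ∀ g, (f g).trace ∈ A := htr
  rw [Algebra.adjoin_range_monoidHom_eq_span]
  let S := Algebra.adjoin K (Set.range f)
  have hSspan : Subalgebra.toSubmodule S = Submodule.span K (Set.range f) :=
    Algebra.adjoin_range_monoidHom_eq_span K f
  have hrep : ∀ g v, glRep ρ g v = (f g).mulVec v := fun g v => Matrix.toLin'_apply _ _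
  have hS : ∀ p : Submodule K (Fin 2 → K), (∀ s ∈ S, ∀ v ∈ p, s.mulVec v ∈ p) →
      ∃ q : Submodule K (Fin 2 → K), (∀ s ∈ S, ∀ v ∈ q, s.mulVec v ∈ q) ∧ IsCompl p q := by
    intro p hp
    obtain ⟨q, hq, hpq⟩ := (glRep ρ).exists_isCompl_invtSubmodule hss (p := p) fun g v hv => by
      rw [hrep]
      exact hp _ (Algebra.subset_adjoin ⟨g, rfl⟩) v hv
    refine ⟨q, fun s hs v hv => ?_, hpq⟩
    rw [← Subalgebra.mem_toSubmodule, hSspan] at hs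
    induction hs using Submodule.span_induction with
    | mem s hs =>
      obtain ⟨g, rfl⟩ := hs
      rw [← hrep]
      exact hq g v hv
    | zero => rw [Matrix.zero_mulVec]; exact q.zero_mem
    | add s t _ _ hs ht => rw [Matrix.add_mulVec]; exact q.add_mem hs ht
    | smul c s _ hs => rw [Matrix.smul_mulVec]; exact q.smul_mem c hs
  obtain ⟨b, hb, hbspan, -⟩ := Submodule.exists_fun_fin_finrank_span_eq K (Set.range f)
  have hmem : ∀ x ∈ Submodule.span A (Set.range f), ∀ i, (x * b i).trace ∈ A := by
    intro x hx i
    obtain ⟨h, hh⟩ := hb i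
    induction hx using Submodule.span_induction with
    | mem s hs =>
      obtain ⟨g, rfl⟩ := hs
      rw [← hh, ← map_mul]
      exact htr _
    | zero => simp
    | add s t _ _ hs ht => rw [add_mul, Matrix.trace_add]; exact A.add_mem hs ht
    | smul c s _ hs =>
      rw [smul_mul_assoc, Matrix.trace_smul]
      exact A.mul_mem c.2 hs
  let φ : Submodule.span A (Set.range f) →ₗ[A] (Fin _ → A) :=
    { toFun := fun x i => ⟨((x : Matrix (Fin 2) (Fin 2) K) * b i).trace, hmem x x.2 i⟩
      map_add' := fun x y => by ext i; simp [add_mul]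
      map_smul' := fun c x => by
        ext i
        simp only [Submodule.coe_smul, smul_mul_assoc, Matrix.trace_smul]
        rfl }
  have hφ : Function.Injective φ := by
    rw [injective_iff_map_eq_zero]
    intro x hx
    have hxS : (x : Matrix (Fin 2) (Fin 2) K) ∈ S := by
      rw [← Subalgebra.mem_toSubmodule, hSspan]
      exact Submodule.span_le_restrictScalars A K _ x.2
    apply Subtype.ext
    refine Matrix.eq_zero_of_forall_trace_mul_eq_zero S hS hxS fun y hy => ?_
    rw [← Subalgebra.mem_toSubmodule, hSspan, ← hbspan] at hy
    induction hy using Submodule.span_induction with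
    | mem s hs =>
      obtain ⟨i, rfl⟩ := hs
      exact congrArg Subtype.val (congrFun hx i)
    | zero => simp
    | add s t _ _ hs ht => rw [mul_add, Matrix.trace_add, hs, ht, add_zero]
    | smul c s _ hs => rw [mul_smul_comm, Matrix.trace_smul, hs, smul_zero]
  have : Module.Finite A (Submodule.span A (Set.range f)) := Module.Finite.of_injective φ hφ
  exact Module.Finite.iff_fg.mp this
end

section
/- B is a finitely generated A-module. -/
theorem glRep_apply {R : Type*} [CommRing R] {G : Type*} [Group G]
    (ρ : G →* Matrix.GeneralLinearGroup (Fin 2) R) (g : G) (v : Fin 2 → R) :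
    glRep ρ g v = (ρ g : Matrix (Fin 2) (Fin 2) R).mulVec v := rfl

/-- A semisimple upper triangular representation of dimension two, in a basis where some element
acts diagonally with distinct eigenvalues, is diagonal. -/
theorem glRep_upper_right_eq_zero_of_isSemisimple {F : Type*} [Field F] {G : Type*} [Group G]
    (σ : G →* Matrix.GeneralLinearGroup (Fin 2) F)
    (hss : IsSemisimpleModule (MonoidAlgebra F G) (glRep σ).asModule)
    {s : G} {x y : F} (hxy : x ≠ y)
    (hs : (σ s : Matrix (Fin 2) (Fin 2) F) = Matrix.diagonal ![x, y])
    (hlow : ∀ g, (σ g : Matrix (Fin 2) (Fin 2) F) 1 0 = 0) (g : G) :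
    (σ g : Matrix (Fin 2) (Fin 2) F) 0 1 = 0 := by
  have hcompl := (Representation.isSemisimpleRepresentation_iff_isSemisimpleModule_asModule
    (glRep σ)).mpr hss
  let L : Subrepresentation (glRep σ) :=
    { toSubmodule := LinearMap.ker (LinearMap.proj (R := F) (φ := fun _ : Fin 2 => F) 1)
      apply_mem_toSubmodule := fun g v hv => by
        have hv1 : v 1 = 0 := hv
        change glRep σ g v 1 = 0
        simp [glRep_apply, Matrix.mulVec, dotProduct, Fin.sum_univ_two, hv1, hlow] }
  obtain ⟨W, hW⟩ := hcompl.exists_isCompl L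
  have hinf : L.toSubmodule ⊓ W.toSubmodule = ⊥ :=
    congrArg Subrepresentation.toSubmodule hW.inf_eq_bot
  have hsup : L.toSubmodule ⊔ W.toSubmodule = ⊤ :=
    congrArg Subrepresentation.toSubmodule hW.sup_eq_top
  have hzero : ∀ v ∈ W.toSubmodule, v 1 = 0 → v 0 = 0 := fun v hv hv1 => by
    have hmem : v ∈ L.toSubmodule ⊓ W.toSubmodule := ⟨hv1, hv⟩
    rw [hinf, Submodule.mem_bot] at hmem
    rw [hmem, Pi.zero_apply]
  obtain ⟨l, hl, w, hw, hlw⟩ := Submodule.mem_sup.mp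
    (hsup ▸ Submodule.mem_top : (![0, 1] : Fin 2 → F) ∈ L.toSubmodule ⊔ W.toSubmodule)
  have hl1 : l 1 = 0 := hl
  have hw1 : w 1 = 1 := by
    have h := congrFun hlw 1
    simpa [hl1] using h
  have hw0 : w 0 = 0 := by
    have h := hzero _ (W.toSubmodule.sub_mem (W.apply_mem_toSubmodule s hw)
      (W.toSubmodule.smul_mem y hw))
      (by simp [glRep_apply, hs])
    have h' : (x - y) * w 0 = 0 := by
      simpa [glRep_apply, hs, Matrix.mulVec_diagonal, sub_mul] using h
    exact (mul_eq_zero.mp h').resolve_left (sub_ne_zero.mpr hxy)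
  have h := hzero _ (W.toSubmodule.sub_mem (W.apply_mem_toSubmodule g hw)
    (W.toSubmodule.smul_mem ((σ g : Matrix (Fin 2) (Fin 2) F) 1 1) hw))
    (by simp [glRep_apply, hw0, hw1])
  simpa [glRep_apply, Matrix.mulVec, dotProduct, Fin.sum_univ_two, hw0, hw1] using h

/-- If all traces of `ρ` lie in `A` and `ρ s` is diagonal with eigenvalues in `A` whose difference
is a unit, then the upper left entries of `ρ` lie in `A`. -/
theorem upper_left_mem_range_of_trace_mem_range {G A K : Type*} [Group G] [CommRing A] [CommRing K]
    [Algebra A K] (ρ : G →* Matrix.GeneralLinearGroup (Fin 2) K)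
    (htr : ∀ g, Matrix.trace (ρ g : Matrix (Fin 2) (Fin 2) K) ∈ (algebraMap A K).range)
    {s : G} {x y : A} (hxy : IsUnit (x - y))
    (hs : (ρ s : Matrix (Fin 2) (Fin 2) K)
      = Matrix.diagonal ![algebraMap A K x, algebraMap A K y]) (g : G) :
    (ρ g : Matrix (Fin 2) (Fin 2) K) 0 0 ∈ (algebraMap A K).range := by
  obtain ⟨u, hu⟩ := hxy
  have hinv : algebraMap A K ↑u⁻¹ * (algebraMap A K x - algebraMap A K y) = 1 := by
    rw [← map_sub, ← hu, ← map_mul, Units.inv_mul, map_one]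
  have htrs : Matrix.trace (ρ (s * g) : Matrix (Fin 2) (Fin 2) K)
      = algebraMap A K x * (ρ g : Matrix (Fin 2) (Fin 2) K) 0 0
        + algebraMap A K y * (ρ g : Matrix (Fin 2) (Fin 2) K) 1 1 := by
    simp [Matrix.trace_fin_two, hs, Matrix.diagonal_mul]
  have key : (ρ g : Matrix (Fin 2) (Fin 2) K) 0 0 = algebraMap A K ↑u⁻¹ *
      (Matrix.trace (ρ (s * g) : Matrix (Fin 2) (Fin 2) K)
        - algebraMap A K y * Matrix.trace (ρ g : Matrix (Fin 2) (Fin 2) K)) := by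
    rw [htrs, Matrix.trace_fin_two]
    linear_combination -(ρ g : Matrix (Fin 2) (Fin 2) K) 0 0 * hinv
  rw [key]
  exact mul_mem ⟨_, rfl⟩ (sub_mem (htr _) (mul_mem ⟨_, rfl⟩ (htr _)))

/-- Over a Noetherian ring `A`, a submodule `B` of an `A`-algebra `K` is finitely generated as soon
as finitely many elements `c i` of `K` multiply `B` into `A` and have no common nonzero annihilator
in `B`. -/
theorem Submodule.fg_of_mul_mem_range {A K ι : Type*} [CommRing A] [IsNoetherianRing A] [CommRing K]
    [Algebra A K] [Finite ι] (B : Submodule A K) (c : ι → K)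
    (hmul : ∀ b ∈ B, ∀ i, b * c i ∈ (algebraMap A K).range)
    (hinj : ∀ b ∈ B, (∀ i, b * c i = 0) → b = 0) : B.FG := by
  let N : Submodule A (ι → K) := LinearMap.range ((Algebra.linearMap A K).compLeft ι)
  let Φ : B →ₗ[A] (ι → K) :=
    (LinearMap.pi fun i => (LinearMap.mulRight A (c i))).comp B.subtype
  have hΦ : ∀ b, Φ b ∈ N := fun b => by
    choose f hf using hmul b b.2
    exact ⟨f, funext hf⟩
  have hker : Function.Injective (Φ.codRestrict N hΦ) := by
    rw [← LinearMap.ker_eq_bot, LinearMap.ker_codRestrict, LinearMap.ker_eq_bot']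
    exact fun b hb => Subtype.ext (hinj b b.2 fun i => congrFun hb i)
  have : IsNoetherian A B := isNoetherian_of_injective _ hker
  exact Module.Finite.iff_fg.mp inferInstance

/-- Mazur–Wiles: `B` is a finitely generated `A`-module. -/
theorem B_finitely_generated
    {G : Type*} [Group G]
    {A K : Type*} [CommRing A] [IsReduced A] [IsNoetherianRing A] [IsLocalRing A]
    [HenselianLocalRing A] [CommRing K] [CharZero K] [Algebra A K]
    [IsLocalization (nonZeroDivisors A) K]
    (ρ : G →* Matrix.GeneralLinearGroup (Fin 2) K)
    (T dt : G → A)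
    (hT : ∀ g, algebraMap A K (T g) = Matrix.trace (ρ g : Matrix (Fin 2) (Fin 2) K))
    (hdt : ∀ g, algebraMap A K (dt g) = Matrix.det (ρ g : Matrix (Fin 2) (Fin 2) K))
    (χ₁ χ₂ : G →* (IsLocalRing.ResidueField A)ˣ)
    (hχ : χ₁ ≠ χ₂)
    (hTχ : ∀ g, IsLocalRing.residue A (T g)
      = (χ₁ g : IsLocalRing.ResidueField A) + (χ₂ g : IsLocalRing.ResidueField A))
    (s : G) (hs : χ₁ s ≠ χ₂ s)
    (lam₁ lam₂ : Aˣ)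
    (hlam₁ : IsLocalRing.residue A (lam₁ : A) = χ₁ s)
    (hlam₂ : IsLocalRing.residue A (lam₂ : A) = χ₂ s)
    (hρs : (ρ s : Matrix (Fin 2) (Fin 2) K)
      = Matrix.diagonal ![algebraMap A K (lam₁ : A), algebraMap A K (lam₂ : A)])
    {r : ℕ} (Kj : Fin r → Type*) [∀ j, Field (Kj j)]
    (e : K ≃+* ((j : Fin r) → Kj j))
    (hss : ∀ j : Fin r,
      IsSemisimpleModule (MonoidAlgebra (Kj j) G)
        (glRep ((Units.map
          (((Pi.evalRingHom Kj j).comp e.toRingHom).mapMatrix.toMonoidHom)).comp ρ)).asModule)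
    :
    (Submodule.span A
      (Set.range fun h : G => (ρ h : Matrix (Fin 2) (Fin 2) K) 0 1)).FG := by
  have hunit : IsUnit ((lam₁ : A) - lam₂) := by
    rw [← IsLocalRing.residue_ne_zero_iff_isUnit, map_sub, hlam₁, hlam₂, sub_ne_zero]
    exact fun h => hs (Units.ext h)
  have ha := upper_left_mem_range_of_trace_mem_range (A := A) ρ (fun g => ⟨T g, hT g⟩) hunit hρs
  have hbc (g h : G) : (ρ g : Matrix (Fin 2) (Fin 2) K) 0 1
      * (ρ h : Matrix (Fin 2) (Fin 2) K) 1 0 ∈ (algebraMap A K).range := by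
    have hgh : (ρ g : Matrix (Fin 2) (Fin 2) K) 0 1 * (ρ h : Matrix (Fin 2) (Fin 2) K) 1 0
        = (ρ (g * h) : Matrix (Fin 2) (Fin 2) K) 0 0
          - (ρ g : Matrix (Fin 2) (Fin 2) K) 0 0 * (ρ h : Matrix (Fin 2) (Fin 2) K) 0 0 := by
      simp [Matrix.mul_apply, Fin.sum_univ_two]
    rw [hgh]
    exact sub_mem (ha _) (mul_mem (ha _) (ha _))
  have hsplit (j : Fin r) : ∃ h : G, e ((ρ h : Matrix (Fin 2) (Fin 2) K) 1 0) j = 0 →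
      ∀ g, e ((ρ g : Matrix (Fin 2) (Fin 2) K) 0 1) j = 0 := by
    by_cases hc : ∃ h : G, e ((ρ h : Matrix (Fin 2) (Fin 2) K) 1 0) j ≠ 0
    · exact hc.imp fun h hh h0 => absurd h0 hh
    · push Not at hc
      refine ⟨1, fun _ => glRep_upper_right_eq_zero_of_isSemisimple _ (hss j) (s := s)
        (x := e (algebraMap A K lam₁) j) (y := e (algebraMap A K lam₂) j) ?_ ?_ hc⟩
      · have hne := ((hunit.map (algebraMap A K)).map
          ((Pi.evalRingHom Kj j).comp e.toRingHom)).ne_zero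
        simpa [sub_eq_zero] using hne
      · ext i k
        change e ((ρ s : Matrix (Fin 2) (Fin 2) K) i k) j = _
        rw [hρs]
        fin_cases i <;> fin_cases k <;> simp
  choose t ht using hsplit
  refine Submodule.fg_of_mul_mem_range _
    (fun j => (ρ (t j) : Matrix (Fin 2) (Fin 2) K) 1 0) ?_ ?_
  · intro b hb j
    induction hb using Submodule.span_induction with
    | mem x hx => obtain ⟨g, rfl⟩ := hx; exact hbc g (t j)
    | zero => rw [zero_mul]; exact zero_mem _
    | add x y _ _ hx hy => rw [add_mul]; exact add_mem hx hy
    | smul a x _ hx =>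
      rw [smul_mul_assoc, Algebra.smul_def]
      exact mul_mem ⟨a, rfl⟩ hx
  · intro b hb hb0
    refine e.injective (funext fun j => ?_)
    rw [map_zero, Pi.zero_apply]
    have hj : e b j * e ((ρ (t j) : Matrix (Fin 2) (Fin 2) K) 1 0) j = 0 := by
      rw [← Pi.mul_apply, ← map_mul, hb0 j, map_zero, Pi.zero_apply]
    refine (mul_eq_zero.mp hj).elim id fun h0 => ?_
    clear hj hb0
    induction hb using Submodule.span_induction with
    | mem x hx => obtain ⟨g, rfl⟩ := hx; exact ht j h0 g
    | zero => simp
    | add x y _ _ hx hy => simp [hx, hy]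
    | smul a x _ hx => simp [Algebra.smul_def, hx]
end

section
/- The annihilator of B in A is zero: if α ∈ A satisfies α·b(g) = 0 for all g ∈ G, then α = 0. -/
/-- An irreducible two-dimensional representation is not lower triangular. -/
theorem exists_upper_right_ne_zero_of_isSimpleModule {F G : Type*} [Field F] [Group G]
    (σ : G →* Matrix.GeneralLinearGroup (Fin 2) F)
    (h : IsSimpleModule (MonoidAlgebra F G) (glRep σ).asModule) :
    ∃ g, (σ g : Matrix (Fin 2) (Fin 2) F) 0 1 ≠ 0 := by
  by_contra! hb
  have hirr := (Representation.irreducible_iff_isSimpleModule_asModule (glRep σ)).2 h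
  let W : Subrepresentation (glRep σ) :=
    { toSubmodule := LinearMap.ker (LinearMap.proj (R := F) (φ := fun _ : Fin 2 => F) 0)
      apply_mem_toSubmodule := by
        intro g v hv
        have hv0 : v 0 = 0 := hv
        change ((σ g : Matrix (Fin 2) (Fin 2) F).mulVec v) 0 = 0
        simp [Matrix.mulVec, dotProduct, Fin.sum_univ_two, hv0, hb g] }
  have mem_W (v : Fin 2 → F) : v ∈ W.toSubmodule ↔ v 0 = 0 := Iff.rfl
  rcases hirr.eq_bot_or_eq_top W with hW | hW
  · have h1 : (![0, 1] : Fin 2 → F) ∈ W.toSubmodule := (mem_W _).2 rfl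
    rw [hW] at h1
    have h2 : (![0, 1] : Fin 2 → F) = 0 := h1
    simpa using congrFun h2 1
  · have h1 : (![1, 0] : Fin 2 → F) ∈ W.toSubmodule := by
      rw [hW]
      exact Submodule.mem_top
    simpa using (mem_W _).1 h1

/-- Mazur–Wiles: if all the `ρ_j` are irreducible, the annihilator of `B` in `A`
is zero: if `α ∈ A` kills every `b(g)`, then `α = 0`. -/
theorem annihilator_of_B_eq_bot
    {G : Type*} [Group G]
    {A K : Type*} [CommRing A] [IsReduced A] [IsNoetherianRing A] [IsLocalRing A]
    [HenselianLocalRing A] [CommRing K] [Algebra A K]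
    [IsLocalization (nonZeroDivisors A) K]
    (ρ : G →* Matrix.GeneralLinearGroup (Fin 2) K)
    (T dt : G → A)
    (hT : ∀ g, algebraMap A K (T g) = Matrix.trace (ρ g : Matrix (Fin 2) (Fin 2) K))
    (hdt : ∀ g, algebraMap A K (dt g) = Matrix.det (ρ g : Matrix (Fin 2) (Fin 2) K))
    (χ₁ χ₂ : G →* (IsLocalRing.ResidueField A)ˣ)
    (hχ : χ₁ ≠ χ₂)
    (hTχ : ∀ g, IsLocalRing.residue A (T g)
      = (χ₁ g : IsLocalRing.ResidueField A) + (χ₂ g : IsLocalRing.ResidueField A))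
    (s : G) (hs : χ₁ s ≠ χ₂ s)
    (lam₁ lam₂ : Aˣ)
    (hlam₁ : IsLocalRing.residue A (lam₁ : A) = χ₁ s)
    (hlam₂ : IsLocalRing.residue A (lam₂ : A) = χ₂ s)
    (hρs : (ρ s : Matrix (Fin 2) (Fin 2) K)
      = Matrix.diagonal ![algebraMap A K (lam₁ : A), algebraMap A K (lam₂ : A)])
    {r : ℕ} (Kj : Fin r → Type*) [∀ j, Field (Kj j)]
    (e : K ≃+* ((j : Fin r) → Kj j))
    (hss : ∀ j : Fin r,
      IsSimpleModule (MonoidAlgebra (Kj j) G)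
        (glRep ((Units.map
          (((Pi.evalRingHom Kj j).comp e.toRingHom).mapMatrix.toMonoidHom)).comp ρ)).asModule)
    :
    ∀ α : A, (∀ g : G, algebraMap A K α * (ρ g : Matrix (Fin 2) (Fin 2) K) 0 1 = 0) → α = 0 := by
  intro α hα
  apply IsLocalization.injective K (le_refl (nonZeroDivisors A))
  rw [map_zero]
  apply e.injective
  rw [map_zero]
  funext j
  obtain ⟨g, hg⟩ := exists_upper_right_ne_zero_of_isSimpleModule _ (hss j)
  have hmul := congrFun (congrArg e (hα g)) j
  rw [map_mul, map_zero] at hmul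
  exact (mul_eq_zero.1 hmul).resolve_right hg
end

section
/- Assume dim_k H¹(G, k(χ₁χ₂⁻¹)) = 1 and that the annihilator of B in A is zero. Then B is a free A-module of rank 1, and there exists f ∈ K^× such that B = f·A; equivalently, after replacing the adapted basis (e₁, e₂) by (e₁, f⁻¹·e₂) one has B = A. -/
/-- The `1`-cocycles of `G` with values in the one-dimensional representation `k(χ)`
of a character `χ : G → kˣ` (i.e. `g` acts on `k` by multiplication by `χ(g)`). -/
def oneCocyclesChar {k : Type*} [CommRing k] {G : Type*} [Group G] (χ : G →* kˣ) :
    Submodule k (G → k) where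
  carrier := {f | ∀ g h : G, f (g * h) = f g + (χ g : k) * f h}
  add_mem' := by
    intro f₁ f₂ h₁ h₂ g h
    simp only [Pi.add_apply, h₁ g h, h₂ g h]
    ring
  zero_mem' := by intro g h; simp
  smul_mem' := by
    intro c f hf g h
    simp only [Pi.smul_apply, smul_eq_mul, hf g h]
    ring

/-- The `1`-coboundaries of `G` with values in `k(χ)`. -/
def oneCoboundariesChar {k : Type*} [CommRing k] {G : Type*} [Group G] (χ : G →* kˣ) :
    Submodule k (G → k) :=
  Submodule.span k {f | ∃ x : k, f = fun g => (χ g : k) * x - x}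

/-- `H¹(G, k(χ))`, the first group cohomology of the character `χ`;
one has `Ext¹_{k[G]}(χ₂, χ₁) ≅ H¹(G, k(χ₁χ₂⁻¹))`. -/
abbrev H1Char {k : Type*} [CommRing k] {G : Type*} [Group G] (χ : G →* kˣ) :=
  ↥(oneCocyclesChar χ) ⧸
    Submodule.comap (oneCocyclesChar χ).subtype (oneCoboundariesChar χ)

open scoped TensorProduct

/-- A semisimple two-dimensional representation over a field which is upper triangular and
contains a diagonal matrix with distinct eigenvalues is diagonal. -/
theorem glRep_upper_right_eq_zero_of_isSemisimpleModule {F : Type*} [Field F] {G : Type*} [Group G]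
    (ρ : G →* Matrix.GeneralLinearGroup (Fin 2) F)
    [IsSemisimpleModule (MonoidAlgebra F G) (glRep ρ).asModule]
    (hc : ∀ g, (ρ g : Matrix (Fin 2) (Fin 2) F) 1 0 = 0)
    {s : G} {x y : F} (hxy : x ≠ y)
    (hs : (ρ s : Matrix (Fin 2) (Fin 2) F) = Matrix.diagonal ![x, y]) (g : G) :
    (ρ g : Matrix (Fin 2) (Fin 2) F) 0 1 = 0 := by
  have hap : ∀ (g : G) (v : Fin 2 → F),
      glRep ρ g v = (ρ g : Matrix (Fin 2) (Fin 2) F).mulVec v := fun _ _ => rfl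
  let L : Subrepresentation (glRep ρ) :=
    { toSubmodule := LinearMap.ker (LinearMap.proj (R := F) (φ := fun _ : Fin 2 => F) 1)
      apply_mem_toSubmodule := by
        intro g v hv
        simp only [LinearMap.mem_ker, LinearMap.proj_apply] at hv ⊢
        simp [hap, Matrix.mulVec, dotProduct, Fin.sum_univ_two, hc, hv] }
  have hL : ∀ v : Fin 2 → F, v ∈ L ↔ v 1 = 0 := fun v => Iff.rfl
  obtain ⟨N, hN⟩ := exists_isCompl (Subrepresentation.subrepresentationSubmoduleOrderIso L)
  obtain ⟨M, rfl⟩ := Subrepresentation.subrepresentationSubmoduleOrderIso.surjective N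
  have hLM : IsCompl L M := (OrderIso.isCompl_iff _).mpr hN
  have hdisj : ∀ v : Fin 2 → F, v ∈ M → v 1 = 0 → v = 0 := by
    intro v hv h1
    have hmem : v ∈ (L ⊓ M).toSubmodule := ⟨(hL v).mpr h1, hv⟩
    rw [hLM.inf_eq_bot] at hmem
    exact hmem
  have htop : (![0, 1] : Fin 2 → F) ∈ L.toSubmodule ⊔ M.toSubmodule := by
    rw [← Subrepresentation.toSubmodule_sup, hLM.sup_eq_top]
    trivial
  obtain ⟨u, hu, w, hw, huw⟩ := Submodule.mem_sup.mp htop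
  have hu1 : u 1 = 0 := hu
  have hw1 : w 1 = 1 := by
    have := congrFun huw 1
    simpa [hu1] using this
  have hkill : ∀ g : G, (ρ g : Matrix (Fin 2) (Fin 2) F) 0 0 * w 0 +
      (ρ g : Matrix (Fin 2) (Fin 2) F) 0 1 =
        (ρ g : Matrix (Fin 2) (Fin 2) F) 1 1 * w 0 := by
    intro g
    have hmem : glRep ρ g w - (ρ g : Matrix (Fin 2) (Fin 2) F) 1 1 • w ∈ M.toSubmodule :=
      M.toSubmodule.sub_mem (M.apply_mem_toSubmodule g hw) (M.toSubmodule.smul_mem _ hw)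
    have h0 := congrFun (hdisj _ hmem (by
      simp [hap, hc, hw1])) 0
    simpa [hap, Matrix.mulVec, dotProduct, Fin.sum_univ_two, hw1, sub_eq_zero] using h0
  have hw0 : w 0 = 0 := by
    have h := hkill s
    simp only [hs, Matrix.diagonal_apply_eq, ne_eq, zero_ne_one, not_false_eq_true,
      Matrix.diagonal_apply_ne, Matrix.cons_val_zero, Matrix.cons_val_one, add_zero] at h
    by_contra hne
    exact hxy (mul_right_cancel₀ hne h)
  simpa [hw0] using hkill g

/-- In a total ring of fractions that is a finite product of fields, a submodule with nonzero
projection to each factor contains a non-zero-divisor of the base ring. -/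
theorem exists_nonZeroDivisor_mem_span {A K ι J : Type*} [CommRing A] [CommRing K] [Algebra A K]
    [IsLocalization (nonZeroDivisors A) K] [Fintype J] {F : J → Type*} [∀ j, Field (F j)]
    (e : K ≃+* ((j : J) → F j)) (c : ι → K) (hc : ∀ j, ∃ i, e (c i) j ≠ 0) :
    ∃ σ ∈ nonZeroDivisors A, algebraMap A K σ ∈ Submodule.span A (Set.range c) := by
  classical
  choose i hi using hc
  let x : J → K := fun j => e.symm (Pi.single j (e (c (i j)) j)⁻¹)
  have hx : ∑ j, x j * c (i j) = 1 := by
    apply e.injective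
    rw [map_sum, map_one]
    ext l
    simp only [x, map_mul, RingEquiv.apply_symm_apply, Finset.sum_apply, Pi.mul_apply,
      Pi.one_apply]
    rw [Finset.sum_eq_single l]
    · simp [hi l]
    · intro j _ hj
      simp [Pi.single_eq_of_ne hj.symm]
    · simp
  obtain ⟨σ, hσ⟩ := IsLocalization.exist_integer_multiples (nonZeroDivisors A) Finset.univ x
  refine ⟨σ, σ.2, ?_⟩
  have hsum : algebraMap A K σ = ∑ j, ((σ : A) • x j) * c (i j) := by
    simp only [Algebra.smul_def, mul_assoc, ← Finset.mul_sum, hx, mul_one]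
  rw [hsum]
  refine Submodule.sum_mem _ fun j _ => ?_
  obtain ⟨α, hα⟩ := hσ j (Finset.mem_univ j)
  rw [← hα, ← Algebra.smul_def]
  exact Submodule.smul_mem _ _ (Submodule.subset_span ⟨_, rfl⟩)

/-- Over a Noetherian ring `A`, a submodule of an `A`-algebra which is multiplied into `A` by an
element of `A` whose image is a unit is finitely generated. -/
theorem finite_of_smul_mem_range {A K : Type*} [CommRing A] [IsNoetherianRing A] [CommRing K]
    [Algebra A K] (B : Submodule A K) {σ : A} (hσ : IsUnit (algebraMap A K σ))
    (h : ∀ x ∈ B, σ • x ∈ LinearMap.range (Algebra.linearMap A K)) : Module.Finite A B := by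
  let φ : B →ₗ[A] LinearMap.range (Algebra.linearMap A K) :=
    LinearMap.codRestrict _ (σ • B.subtype) fun x => h x x.2
  refine Module.Finite.of_injective φ fun x y hxy => Subtype.ext ?_
  have hxy' : σ • (x : K) = σ • (y : K) := congrArg Subtype.val hxy
  rw [Algebra.smul_def, Algebra.smul_def] at hxy'
  exact hσ.mul_left_cancel hxy'

/-- The cocycle on `G` attached to a linear form on the fibre of a module generated by a
`(χ₁, χ₂)`-cocycle. -/
noncomputable def dualFibreToCocycles {A : Type*} [CommRing A] [IsLocalRing A] {G : Type*} [Group G]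
    {M : Type*} [AddCommGroup M] [Module A M] (χ₁ χ₂ : G →* (IsLocalRing.ResidueField A)ˣ)
    (a d : G → A) (ha : ∀ g, IsLocalRing.residue A (a g) = χ₁ g)
    (hd : ∀ g, IsLocalRing.residue A (d g) = χ₂ g)
    (β : G → M) (hβ : ∀ g h, β (g * h) = a g • β h + d h • β g) :
    Module.Dual (IsLocalRing.ResidueField A) (IsLocalRing.ResidueField A ⊗[A] M)
      →ₗ[IsLocalRing.ResidueField A] oneCocyclesChar (χ₁ * χ₂⁻¹) where
  toFun φ := ⟨fun g => ((χ₂ g)⁻¹ : (IsLocalRing.ResidueField A)ˣ) * φ (1 ⊗ₜ β g), by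
    have hsmul : ∀ (α : A) (m : M), φ (1 ⊗ₜ (α • m)) = IsLocalRing.residue A α * φ (1 ⊗ₜ m) := by
      intro α m
      rw [TensorProduct.tmul_smul, ← algebraMap_smul (IsLocalRing.ResidueField A) α, map_smul,
        smul_eq_mul, IsLocalRing.ResidueField.algebraMap_eq]
    intro g h
    have h₁ : ((χ₂ h)⁻¹ : (IsLocalRing.ResidueField A)ˣ) *
        (χ₂ h : IsLocalRing.ResidueField A) = 1 := Units.inv_mul _
    simp only [hβ, TensorProduct.tmul_add, map_add, hsmul, ha, hd, map_mul, mul_inv,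
      MonoidHom.mul_apply, MonoidHom.inv_apply, Units.val_mul]
    linear_combination (((χ₂ g)⁻¹ : (IsLocalRing.ResidueField A)ˣ) * φ (1 ⊗ₜ β g)) * h₁⟩
  map_add' φ ψ := by
    ext g
    simp [mul_add]
  map_smul' c φ := by
    ext g
    simp [mul_left_comm]

/-- If `H¹(G, k(χ₁χ₂⁻¹))` is one-dimensional, a finite module generated by a `(χ₁, χ₂)`-cocycle
vanishing at an element that separates `χ₁` from `χ₂` is cyclic. -/
theorem exists_span_singleton_eq_top_of_rank_H1Char {A : Type*} [CommRing A] [IsLocalRing A]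
    {G : Type*} [Group G] {M : Type*} [AddCommGroup M] [Module A M] [Module.Finite A M]
    (χ₁ χ₂ : G →* (IsLocalRing.ResidueField A)ˣ)
    (a d : G → A) (ha : ∀ g, IsLocalRing.residue A (a g) = χ₁ g)
    (hd : ∀ g, IsLocalRing.residue A (d g) = χ₂ g)
    (β : G → M) (hβ : ∀ g h, β (g * h) = a g • β h + d h • β g)
    (hspan : Submodule.span A (Set.range β) = ⊤)
    {s : G} (hs : χ₁ s ≠ χ₂ s) (hβs : β s = 0)
    (hdim : Module.rank (IsLocalRing.ResidueField A) (H1Char (χ₁ * χ₂⁻¹)) = 1) :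
    ∃ f : M, Submodule.span A {f} = ⊤ := by
  have hfin : Module.Finite (IsLocalRing.ResidueField A) (H1Char (χ₁ * χ₂⁻¹)) :=
    Module.finite_of_rank_eq_one hdim
  let Ψ := dualFibreToCocycles χ₁ χ₂ a d ha hd β hβ
  let Φ := (Submodule.mkQ (Submodule.comap (oneCocyclesChar (χ₁ * χ₂⁻¹)).subtype
    (oneCoboundariesChar (χ₁ * χ₂⁻¹)))).comp Ψ
  have hΨ : ∀ φ g, (Ψ φ : G → IsLocalRing.ResidueField A) g =
      ((χ₂ g)⁻¹ : (IsLocalRing.ResidueField A)ˣ) * φ (1 ⊗ₜ β g) := fun _ _ => rfl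
  have hinj : Function.Injective Φ := by
    rw [injective_iff_map_eq_zero]
    intro φ hφ
    have hmem : (Ψ φ : G → IsLocalRing.ResidueField A) ∈ oneCoboundariesChar (χ₁ * χ₂⁻¹) :=
      Submodule.mem_comap.mp ((Submodule.Quotient.mk_eq_zero (Submodule.comap
        (oneCocyclesChar (χ₁ * χ₂⁻¹)).subtype (oneCoboundariesChar (χ₁ * χ₂⁻¹)))).mp hφ)
    have hcob : ∀ F ∈ oneCoboundariesChar (χ₁ * χ₂⁻¹), ∃ x : IsLocalRing.ResidueField A,
        F = fun g => (((χ₁ * χ₂⁻¹) g : (IsLocalRing.ResidueField A)ˣ) :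
          IsLocalRing.ResidueField A) * x - x := by
      intro F hF
      induction hF using Submodule.span_induction with
      | mem F hF => exact hF
      | zero => exact ⟨0, by ext; simp⟩
      | add F F' _ _ h h' =>
        obtain ⟨⟨x, rfl⟩, ⟨x', rfl⟩⟩ := And.intro h h'
        exact ⟨x + x', by ext; simp only [Pi.add_apply]; ring⟩
      | smul c F _ h =>
        obtain ⟨x, rfl⟩ := h
        exact ⟨c * x, by ext; simp only [Pi.smul_apply, smul_eq_mul]; ring⟩
    obtain ⟨x, hx⟩ := hcob _ hmem
    have hx0 : x = 0 := by
      have h := congrFun hx s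
      rw [hΨ, hβs, TensorProduct.tmul_zero, map_zero, mul_zero] at h
      by_contra hne
      refine hs ?_
      have h1 : (((χ₁ * χ₂⁻¹) s : (IsLocalRing.ResidueField A)ˣ) :
          IsLocalRing.ResidueField A) = 1 :=
        mul_right_cancel₀ hne (by rw [one_mul]; exact (sub_eq_zero.mp h.symm))
      rw [Units.val_eq_one, MonoidHom.mul_apply, MonoidHom.inv_apply] at h1
      exact mul_inv_eq_one.mp h1
    have hφβ : ∀ g, φ (1 ⊗ₜ β g) = 0 := by
      intro g
      have h := congrFun hx g
      rw [hΨ, hx0, mul_zero, sub_zero] at h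
      exact (Units.mul_right_eq_zero _).mp h
    have hφM : ∀ m : M, φ (1 ⊗ₜ m) = 0 := by
      intro m
      have hm : m ∈ Submodule.span A (Set.range β) := hspan ▸ Submodule.mem_top
      induction hm using Submodule.span_induction with
      | mem m hm => obtain ⟨g, rfl⟩ := hm; exact hφβ g
      | zero => simp
      | add m m' _ _ h h' => rw [TensorProduct.tmul_add, map_add, h, h', add_zero]
      | smul c m _ h =>
        rw [TensorProduct.tmul_smul, ← algebraMap_smul (IsLocalRing.ResidueField A) c, map_smul,
          h, smul_zero]
    ext m
    simpa using hφM m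
  have hle : Module.finrank (IsLocalRing.ResidueField A) (IsLocalRing.ResidueField A ⊗[A] M) ≤ 1 := by
    rw [← Subspace.dual_finrank_eq]
    exact (LinearMap.finrank_le_finrank_of_injective hinj).trans
      (Module.rank_eq_one_iff_finrank_eq_one.mp hdim).le
  obtain ⟨v, hv⟩ := finrank_le_one_iff.mp hle
  obtain ⟨f, rfl⟩ := TensorProduct.mk_surjective A M (IsLocalRing.ResidueField A)
    IsLocalRing.residue_surjective v
  refine ⟨f, IsLocalRing.map_tensorProduct_mk_eq_top.mp (eq_top_iff.mpr fun w _ => ?_)⟩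
  obtain ⟨c, rfl⟩ := hv w
  obtain ⟨α, rfl⟩ := IsLocalRing.residue_surjective c
  exact ⟨α • f, Submodule.smul_mem _ _ (Submodule.mem_span_singleton_self f), by
    rw [map_smul, ← IsLocalRing.ResidueField.algebraMap_eq, algebraMap_smul]⟩

/-- Mazur–Wiles: if `dim_k H¹(G, k(χ₁χ₂⁻¹)) = 1` and the annihilator of `B` in `A` is
zero, then `B` is a free `A`-module of rank `1`, generated by some `f ∈ Kˣ`. -/
theorem B_free_of_rank_one
    {G : Type*} [Group G]
    {A K : Type*} [CommRing A] [IsReduced A] [IsNoetherianRing A] [IsLocalRing A]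
    [HenselianLocalRing A] [CommRing K] [CharZero K] [Algebra A K]
    [IsLocalization (nonZeroDivisors A) K]
    (ρ : G →* Matrix.GeneralLinearGroup (Fin 2) K)
    (T dt : G → A)
    (hT : ∀ g, algebraMap A K (T g) = Matrix.trace (ρ g : Matrix (Fin 2) (Fin 2) K))
    (hdt : ∀ g, algebraMap A K (dt g) = Matrix.det (ρ g : Matrix (Fin 2) (Fin 2) K))
    (χ₁ χ₂ : G →* (IsLocalRing.ResidueField A)ˣ)
    (hχ : χ₁ ≠ χ₂)
    (hTχ : ∀ g, IsLocalRing.residue A (T g)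
      = (χ₁ g : IsLocalRing.ResidueField A) + (χ₂ g : IsLocalRing.ResidueField A))
    (s : G) (hs : χ₁ s ≠ χ₂ s)
    (lam₁ lam₂ : Aˣ)
    (hlam₁ : IsLocalRing.residue A (lam₁ : A) = χ₁ s)
    (hlam₂ : IsLocalRing.residue A (lam₂ : A) = χ₂ s)
    (hρs : (ρ s : Matrix (Fin 2) (Fin 2) K)
      = Matrix.diagonal ![algebraMap A K (lam₁ : A), algebraMap A K (lam₂ : A)])
    {r : ℕ} (Kj : Fin r → Type*) [∀ j, Field (Kj j)]
    (e : K ≃+* ((j : Fin r) → Kj j))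
    (hss : ∀ j : Fin r,
      IsSemisimpleModule (MonoidAlgebra (Kj j) G)
        (glRep ((Units.map
          (((Pi.evalRingHom Kj j).comp e.toRingHom).mapMatrix.toMonoidHom)).comp ρ)).asModule)
    (hdim : Module.rank (IsLocalRing.ResidueField A) (H1Char (χ₁ * χ₂⁻¹)) = 1)
    (hann : ∀ α : A,
      (∀ g : G, algebraMap A K α * (ρ g : Matrix (Fin 2) (Fin 2) K) 0 1 = 0) → α = 0)
    :
    Module.Free A
      ↥(Submodule.span A (Set.range fun h : G => (ρ h : Matrix (Fin 2) (Fin 2) K) 0 1)) ∧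
    Module.rank A
      ↥(Submodule.span A (Set.range fun h : G => (ρ h : Matrix (Fin 2) (Fin 2) K) 0 1)) = 1 ∧
    ∃ f : Kˣ,
      Submodule.span A (Set.range fun h : G => (ρ h : Matrix (Fin 2) (Fin 2) K) 0 1)
        = Submodule.span A {(f : K)} := by
  have hmul : ∀ g h i j, ((ρ g * ρ h : Matrix.GeneralLinearGroup (Fin 2) K) :
      Matrix (Fin 2) (Fin 2) K) i j =
      (ρ g : Matrix (Fin 2) (Fin 2) K) i 0 * (ρ h : Matrix (Fin 2) (Fin 2) K) 0 j +
      (ρ g : Matrix (Fin 2) (Fin 2) K) i 1 * (ρ h : Matrix (Fin 2) (Fin 2) K) 1 j := by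
    intro g h i j
    rw [Units.val_mul, Matrix.mul_apply, Fin.sum_univ_two]
  have hs00 : (ρ s : Matrix (Fin 2) (Fin 2) K) 0 0 = algebraMap A K lam₁ := by simp [hρs]
  have hs01 : (ρ s : Matrix (Fin 2) (Fin 2) K) 0 1 = 0 := by simp [hρs]
  have hs10 : (ρ s : Matrix (Fin 2) (Fin 2) K) 1 0 = 0 := by simp [hρs]
  have hs11 : (ρ s : Matrix (Fin 2) (Fin 2) K) 1 1 = algebraMap A K lam₂ := by simp [hρs]
  have hresne : (χ₁ s : IsLocalRing.ResidueField A) - χ₂ s ≠ 0 :=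
    sub_ne_zero.mpr fun h => hs (Units.ext h)
  have hunit : IsUnit ((lam₁ : A) - lam₂) := by
    rw [← IsLocalRing.residue_ne_zero_iff_isUnit, map_sub, hlam₁, hlam₂]
    exact hresne
  obtain ⟨μ, hμ⟩ := hunit.exists_left_inv
  have hμK : algebraMap A K μ * (algebraMap A K lam₁ - algebraMap A K lam₂) = 1 := by
    rw [← map_sub, ← map_mul, hμ, map_one]
  have hμk : IsLocalRing.residue A μ *
      ((χ₁ s : IsLocalRing.ResidueField A) - χ₂ s) = 1 := by
    rw [← hlam₁, ← hlam₂, ← map_sub, ← map_mul, hμ, map_one]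
  let a : G → A := fun g => μ * (T (s * g) - lam₂ * T g)
  let d : G → A := fun g => μ * (lam₁ * T g - T (s * g))
  have haK : ∀ g, algebraMap A K (a g) = (ρ g : Matrix (Fin 2) (Fin 2) K) 0 0 := by
    intro g
    simp only [a, map_mul, map_sub, hT, Matrix.trace_fin_two, hmul, hs00, hs01, hs10, hs11]
    linear_combination (ρ g : Matrix (Fin 2) (Fin 2) K) 0 0 * hμK
  have hdK : ∀ g, algebraMap A K (d g) = (ρ g : Matrix (Fin 2) (Fin 2) K) 1 1 := by
    intro g
    simp only [d, map_mul, map_sub, hT, Matrix.trace_fin_two, hmul, hs00, hs01, hs10, hs11]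
    linear_combination (ρ g : Matrix (Fin 2) (Fin 2) K) 1 1 * hμK
  have hak : ∀ g, IsLocalRing.residue A (a g) = χ₁ g := by
    intro g
    simp only [a, map_mul, map_sub, hTχ, hlam₂, Units.val_mul]
    linear_combination (χ₁ g : IsLocalRing.ResidueField A) * hμk
  have hdk : ∀ g, IsLocalRing.residue A (d g) = χ₂ g := by
    intro g
    simp only [d, map_mul, map_sub, hTχ, hlam₁, Units.val_mul]
    linear_combination (χ₂ g : IsLocalRing.ResidueField A) * hμk
  have hb : ∀ j, ∃ g, e ((ρ g : Matrix (Fin 2) (Fin 2) K) 0 1) j ≠ 0 := by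
    intro j
    by_contra! hj
    obtain ⟨σ, α, hα⟩ := IsLocalization.exists_integer_multiple (nonZeroDivisors A)
      (e.symm (Pi.single j 1))
    have hσ : IsUnit (algebraMap A K σ) := IsLocalization.map_units K σ
    have hα0 : α = 0 := by
      refine hann α fun g => ?_
      have hprod : e.symm (Pi.single j 1) * (ρ g : Matrix (Fin 2) (Fin 2) K) 0 1 = 0 := by
        apply e.injective
        rw [map_mul, RingEquiv.apply_symm_apply, map_zero]
        ext l
        by_cases hl : l = j
        · subst hl
          simp [hj g]
        · simp [Pi.single_eq_of_ne hl]
      rw [hα, Algebra.smul_def, mul_assoc, hprod, mul_zero]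
    rw [hα0, map_zero, Algebra.smul_def, eq_comm, hσ.mul_right_eq_zero,
      EmbeddingLike.map_eq_zero_iff, Pi.single_eq_zero_iff] at hα
    exact one_ne_zero hα
  have hc : ∀ j, ∃ g, e ((ρ g : Matrix (Fin 2) (Fin 2) K) 1 0) j ≠ 0 := by
    intro j
    by_contra! hj
    obtain ⟨g, hg⟩ := hb j
    have := hss j
    let π : K →+* Kj j := (Pi.evalRingHom Kj j).comp e.toRingHom
    refine hg (glRep_upper_right_eq_zero_of_isSemisimpleModule
      ((Units.map (RingHom.mapMatrix (m := Fin 2) π).toMonoidHom).comp ρ) hj (s := s)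
      (x := π (algebraMap A K lam₁)) (y := π (algebraMap A K lam₂)) ?_ ?_ g)
    · rw [← sub_ne_zero, ← map_sub, ← map_sub]
      exact ((hunit.map _).map _).ne_zero
    · change (ρ s : Matrix (Fin 2) (Fin 2) K).map π = _
      rw [hρs]
      ext i l
      fin_cases i <;> fin_cases l <;> simp
  obtain ⟨σ, hσ, hσC⟩ := exists_nonZeroDivisor_mem_span (A := A) e
    (fun g => (ρ g : Matrix (Fin 2) (Fin 2) K) 1 0) hc
  set B : Submodule A K :=
    Submodule.span A (Set.range fun h : G => (ρ h : Matrix (Fin 2) (Fin 2) K) 0 1) with hB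
  have hBC : B * Submodule.span A (Set.range fun g => (ρ g : Matrix (Fin 2) (Fin 2) K) 1 0) ≤
      LinearMap.range (Algebra.linearMap A K) := by
    rw [hB, Submodule.span_mul_span, Submodule.span_le]
    rintro _ ⟨_, ⟨g, rfl⟩, _, ⟨h, rfl⟩, rfl⟩
    refine ⟨a (g * h) - a g * a h, ?_⟩
    simp only [Algebra.linearMap_apply, map_sub, map_mul, haK, hmul]
    ring
  have : Module.Finite A B := by
    refine finite_of_smul_mem_range B (IsLocalization.map_units K ⟨σ, hσ⟩) fun x hx => ?_
    rw [Algebra.smul_def, mul_comm]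
    exact hBC (Submodule.mul_mem_mul hx hσC)
  let β : G → B := fun g =>
    ⟨(ρ g : Matrix (Fin 2) (Fin 2) K) 0 1, Submodule.subset_span ⟨g, rfl⟩⟩
  obtain ⟨f, hf⟩ := exists_span_singleton_eq_top_of_rank_H1Char χ₁ χ₂ a d hak hdk β
    (fun g h => Subtype.ext (by
      simp only [β, map_mul, hmul, Submodule.coe_add, Submodule.coe_smul, Algebra.smul_def,
        haK, hdK]
      ring))
    (by
      apply Submodule.map_injective_of_injective B.injective_subtype
      rw [Submodule.map_span, Submodule.map_top, Submodule.range_subtype, ← Set.range_comp]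
      rfl)
    hs (Subtype.ext hs01) hdim
  have hBf : B = Submodule.span A {(f : K)} := by
    have hmap := congrArg (Submodule.map B.subtype) hf
    rw [Submodule.map_span, Set.image_singleton, Submodule.map_top, Submodule.range_subtype] at hmap
    exact hmap.symm
  have hf0 : ∀ α : A, algebraMap A K α * (f : K) = 0 → α = 0 := by
    intro α hα
    refine hann α fun g => ?_
    have hg : (ρ g : Matrix (Fin 2) (Fin 2) K) 0 1 ∈ Submodule.span A {(f : K)} :=
      hBf ▸ (β g).2
    obtain ⟨γ, hγ⟩ := Submodule.mem_span_singleton.mp hg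
    rw [← hγ, Algebra.smul_def, mul_left_comm, hα, mul_zero]
  let ε : A ≃ₗ[A] B := LinearEquiv.ofBijective (LinearMap.toSpanSingleton A B f)
    ⟨by
      rw [injective_iff_map_eq_zero]
      intro α hα
      refine hf0 α ?_
      rw [← Algebra.smul_def]
      exact congrArg Subtype.val hα,
    by
      rw [← LinearMap.range_eq_top, LinearMap.range_toSpanSingleton]
      exact hf⟩
  have hfunit : IsUnit (f : K) := by
    obtain ⟨τ, α, hα⟩ := IsLocalization.exists_integer_multiple (nonZeroDivisors A) (f : K)
    have hαnzd : α ∈ nonZeroDivisors A := by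
      rw [mem_nonZeroDivisors_iff_right]
      intro γ hγ
      refine hf0 γ ((IsLocalization.map_units K τ).mul_right_eq_zero.mp ?_)
      rw [mul_left_comm, ← Algebra.smul_def (τ : A), ← hα, ← map_mul, hγ, map_zero]
    have hαunit : IsUnit (algebraMap A K α) := IsLocalization.map_units K ⟨α, hαnzd⟩
    rw [hα, Algebra.smul_def] at hαunit
    exact isUnit_of_mul_isUnit_right hαunit
  refine ⟨Module.Free.of_equiv ε, ?_, hfunit.unit, hBf⟩
  have hrank := ε.lift_rank_eq
  rw [Module.rank_self, Cardinal.lift_one, eq_comm, Cardinal.lift_eq_one] at hrank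
  exact hrank
end

section
/- All products b(g)·c(g') (g, g' ∈ G) lie in the maximal ideal m; let J₀ := BC be the ideal of A they generate. Then: (i) the maps g ↦ a(g) mod J₀ and g ↦ d(g) mod J₀ are group homomorphisms G → (A/J₀)^× reducing modulo m to χ₁ and χ₂ respectively, and the reduction of T modulo J₀ equals their sum; (ii) conversely, for every proper ideal J of A such that T mod J = ψ₁ + ψ₂ for some group homomorphisms ψ₁, ψ₂ : G → (A/J)^× with ψᵢ ≡ χᵢ mod m, one has J₀ ⊆ J. Thus J₀ = BC is the smallest ideal J of A such that T mod J is the sum of two characters lifting χ₁ and χ₂ (the reducibility ideal of T). -/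
/-- A pair `(p, q)` with the same first three power sums as `(l₁, l₂)` equals `(l₁, l₂)` in the
first coordinate, once `p - q` and `p - l₂` are units. -/
lemma eq_of_power_sums_eq_s14 {R : Type*} [CommRing R] {p q l₁ l₂ : R}
    (h₁ : p + q = l₁ + l₂) (h₂ : p ^ 2 + q ^ 2 = l₁ ^ 2 + l₂ ^ 2)
    (h₃ : p ^ 3 + q ^ 3 = l₁ ^ 3 + l₂ ^ 3)
    (hpq : IsUnit (p - q)) (hpl : IsUnit (p - l₂)) : p = l₁ := by
  have key : (p - q) * ((p - l₂) * (p - l₁)) = (p - q) * ((p - l₂) * 0) := by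
    linear_combination h₃ - (l₁ + l₂ + q) * h₂ + (l₁ * l₂ + q * (l₁ + l₂)) * h₁
  exact sub_eq_zero.mp (hpl.mul_left_cancel (hpq.mul_left_cancel key))

/-- A map into a commutative ring that is multiplicative and sends `1` to `1` on a group is a
character. -/
lemma exists_monoidHom_units {G R : Type*} [Group G] [CommRing R] (f : G → R)
    (hone : f 1 = 1) (hmul : ∀ g h, f (g * h) = f g * f h) :
    ∃ ψ : G →* Rˣ, ∀ g, (ψ g : R) = f g :=
  ⟨MonoidHom.toHomUnits ⟨⟨f, hone⟩, hmul⟩, fun _ => rfl⟩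


/-- Mazur–Wiles: the products `b(g)·c(g')` lie in the maximal ideal `m`; the ideal
`J₀ = BC` of `A` they generate satisfies: (i) the reductions of `a` and `d` mod `J₀` are
group homomorphisms into `(A/J₀)ˣ` lifting `χ₁` and `χ₂` whose sum is `T mod J₀`;
(ii) `J₀` is contained in every proper ideal `J` of `A` such that `T mod J` is the sum of
two characters lifting `χ₁` and `χ₂`.  Thus `J₀` is the reducibility ideal of `T`. -/
theorem reducibility_ideal_spec
    {G : Type*} [Group G]
    {A K : Type*} [CommRing A] [IsReduced A] [IsNoetherianRing A] [IsLocalRing A]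
    [HenselianLocalRing A] [CommRing K] [Algebra A K]
    [IsLocalization (nonZeroDivisors A) K]
    (ρ : G →* Matrix.GeneralLinearGroup (Fin 2) K)
    (T dt : G → A)
    (hT : ∀ g, algebraMap A K (T g) = Matrix.trace (ρ g : Matrix (Fin 2) (Fin 2) K))
    (hdt : ∀ g, algebraMap A K (dt g) = Matrix.det (ρ g : Matrix (Fin 2) (Fin 2) K))
    (χ₁ χ₂ : G →* (IsLocalRing.ResidueField A)ˣ)
    (hχ : χ₁ ≠ χ₂)
    (hTχ : ∀ g, IsLocalRing.residue A (T g)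
      = (χ₁ g : IsLocalRing.ResidueField A) + (χ₂ g : IsLocalRing.ResidueField A))
    (s : G) (hs : χ₁ s ≠ χ₂ s)
    (lam₁ lam₂ : Aˣ)
    (hlam₁ : IsLocalRing.residue A (lam₁ : A) = χ₁ s)
    (hlam₂ : IsLocalRing.residue A (lam₂ : A) = χ₂ s)
    (hρs : (ρ s : Matrix (Fin 2) (Fin 2) K)
      = Matrix.diagonal ![algebraMap A K (lam₁ : A), algebraMap A K (lam₂ : A)])
    :
    (∀ g g' : G, ∃ x : A, x ∈ IsLocalRing.maximalIdeal A ∧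
      algebraMap A K x
        = (ρ g : Matrix (Fin 2) (Fin 2) K) 0 1 * (ρ g' : Matrix (Fin 2) (Fin 2) K) 1 0) ∧
    (∃ aA dA : G → A,
      (∀ g : G, algebraMap A K (aA g) = (ρ g : Matrix (Fin 2) (Fin 2) K) 0 0 ∧
        algebraMap A K (dA g) = (ρ g : Matrix (Fin 2) (Fin 2) K) 1 1) ∧
      ∃ ψ₁ ψ₂ : G →* (A ⧸ (Ideal.span {x : A | ∃ g g' : G,
        algebraMap A K x
          = (ρ g : Matrix (Fin 2) (Fin 2) K) 0 1 * (ρ g' : Matrix (Fin 2) (Fin 2) K) 1 0}))ˣ,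
        (∀ g : G,
          (ψ₁ g : A ⧸ (Ideal.span {x : A | ∃ g g' : G,
        algebraMap A K x
          = (ρ g : Matrix (Fin 2) (Fin 2) K) 0 1 * (ρ g' : Matrix (Fin 2) (Fin 2) K) 1 0})) = Ideal.Quotient.mk _ (aA g) ∧
          (ψ₂ g : A ⧸ (Ideal.span {x : A | ∃ g g' : G,
        algebraMap A K x
          = (ρ g : Matrix (Fin 2) (Fin 2) K) 0 1 * (ρ g' : Matrix (Fin 2) (Fin 2) K) 1 0})) = Ideal.Quotient.mk _ (dA g)) ∧
        (∀ g : G, ∀ x : A,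
          Ideal.Quotient.mk _ x = (ψ₁ g : A ⧸ (Ideal.span {x : A | ∃ g g' : G,
        algebraMap A K x
          = (ρ g : Matrix (Fin 2) (Fin 2) K) 0 1 * (ρ g' : Matrix (Fin 2) (Fin 2) K) 1 0})) → IsLocalRing.residue A x = χ₁ g) ∧
        (∀ g : G, ∀ x : A,
          Ideal.Quotient.mk _ x = (ψ₂ g : A ⧸ (Ideal.span {x : A | ∃ g g' : G,
        algebraMap A K x
          = (ρ g : Matrix (Fin 2) (Fin 2) K) 0 1 * (ρ g' : Matrix (Fin 2) (Fin 2) K) 1 0})) → IsLocalRing.residue A x = χ₂ g) ∧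
        (∀ g : G,
          Ideal.Quotient.mk _ (T g)
            = (ψ₁ g : A ⧸ (Ideal.span {x : A | ∃ g g' : G,
        algebraMap A K x
          = (ρ g : Matrix (Fin 2) (Fin 2) K) 0 1 * (ρ g' : Matrix (Fin 2) (Fin 2) K) 1 0})) + (ψ₂ g : A ⧸ (Ideal.span {x : A | ∃ g g' : G,
        algebraMap A K x
          = (ρ g : Matrix (Fin 2) (Fin 2) K) 0 1 * (ρ g' : Matrix (Fin 2) (Fin 2) K) 1 0})))) ∧
    (∀ J : Ideal A, J ≠ ⊤ → ∀ ψ₁ ψ₂ : G →* (A ⧸ J)ˣ,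
      (∀ g : G, Ideal.Quotient.mk J (T g) = (ψ₁ g : A ⧸ J) + (ψ₂ g : A ⧸ J)) →
      (∀ g : G, ∀ x : A,
        Ideal.Quotient.mk J x = (ψ₁ g : A ⧸ J) → IsLocalRing.residue A x = χ₁ g) →
      (∀ g : G, ∀ x : A,
        Ideal.Quotient.mk J x = (ψ₂ g : A ⧸ J) → IsLocalRing.residue A x = χ₂ g) →
      (Ideal.span {x : A | ∃ g g' : G,
        algebraMap A K x
          = (ρ g : Matrix (Fin 2) (Fin 2) K) 0 1 * (ρ g' : Matrix (Fin 2) (Fin 2) K) 1 0}) ≤ J) := by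
  have hinj : Function.Injective (algebraMap A K) := IsLocalization.injective K le_rfl
  have hs' : (χ₁ s : IsLocalRing.ResidueField A) - χ₂ s ≠ 0 :=
    sub_ne_zero.mpr fun h => hs (Units.ext h)
  obtain ⟨u, hu⟩ : ∃ u : A, (lam₁ - lam₂ : A) * u = 1 :=
    ((IsLocalRing.residue_ne_zero_iff_isUnit _).mp (by rwa [map_sub, hlam₁, hlam₂])).exists_right_inv
  have huK : (algebraMap A K lam₁ - algebraMap A K lam₂) * algebraMap A K u = 1 := by
    rw [← map_sub, ← map_mul, hu, map_one]
  have huk : ((χ₁ s : IsLocalRing.ResidueField A) - χ₂ s) * IsLocalRing.residue A u = 1 := by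
    rw [← hlam₁, ← hlam₂, ← map_sub, ← map_mul, hu, map_one]
  have hmul : ∀ g h i j, (ρ (g * h) : Matrix (Fin 2) (Fin 2) K) i j
      = (ρ g : Matrix (Fin 2) (Fin 2) K) i 0 * (ρ h : Matrix (Fin 2) (Fin 2) K) 0 j
        + (ρ g : Matrix (Fin 2) (Fin 2) K) i 1 * (ρ h : Matrix (Fin 2) (Fin 2) K) 1 j := by
    intro g h i j
    rw [map_mul, Matrix.GeneralLinearGroup.coe_mul, Matrix.mul_apply, Fin.sum_univ_two]
  have hTe : ∀ g, algebraMap A K (T g) = (ρ g : Matrix (Fin 2) (Fin 2) K) 0 0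
      + (ρ g : Matrix (Fin 2) (Fin 2) K) 1 1 := fun g => by rw [hT, Matrix.trace_fin_two]
  have hTs : ∀ g, algebraMap A K (T (s * g))
      = algebraMap A K lam₁ * (ρ g : Matrix (Fin 2) (Fin 2) K) 0 0
        + algebraMap A K lam₂ * (ρ g : Matrix (Fin 2) (Fin 2) K) 1 1 := by
    intro g
    rw [hTe, hmul, hmul, hρs]
    simp
  obtain ⟨a, ha⟩ : ∃ a : G → A, ∀ g, a g = (T (s * g) - lam₂ * T g) * u := ⟨_, fun _ => rfl⟩
  obtain ⟨d, hd⟩ : ∃ d : G → A, ∀ g, d g = (lam₁ * T g - T (s * g)) * u := ⟨_, fun _ => rfl⟩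
  have haK : ∀ g, algebraMap A K (a g) = (ρ g : Matrix (Fin 2) (Fin 2) K) 0 0 := by
    intro g
    rw [ha, map_mul, map_sub, map_mul, hTs, hTe]
    linear_combination (ρ g : Matrix (Fin 2) (Fin 2) K) 0 0 * huK
  have hdK : ∀ g, algebraMap A K (d g) = (ρ g : Matrix (Fin 2) (Fin 2) K) 1 1 := by
    intro g
    rw [hd, map_mul, map_sub, map_mul, hTs, hTe]
    linear_combination (ρ g : Matrix (Fin 2) (Fin 2) K) 1 1 * huK
  have hTad : ∀ g, T g = a g + d g := fun g => hinj (by rw [map_add, haK, hdK, hTe])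
  have hTs' : ∀ g, T (s * g) = lam₁ * a g + lam₂ * d g := fun g =>
    hinj (by rw [map_add, map_mul, map_mul, haK, hdK, hTs])
  have hares : ∀ g, IsLocalRing.residue A (a g) = χ₁ g := by
    intro g
    rw [ha, map_mul, map_sub, map_mul, hTχ, hTχ, hlam₂, map_mul, map_mul, Units.val_mul,
      Units.val_mul]
    linear_combination (χ₁ g : IsLocalRing.ResidueField A) * huk
  have hdres : ∀ g, IsLocalRing.residue A (d g) = χ₂ g := by
    intro g
    have h := hTχ g
    rw [hTad, map_add, hares] at h
    exact add_left_cancel h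
  have hbc : ∀ g g', algebraMap A K (a (g * g') - a g * a g')
      = (ρ g : Matrix (Fin 2) (Fin 2) K) 0 1 * (ρ g' : Matrix (Fin 2) (Fin 2) K) 1 0 := by
    intro g g'
    rw [map_sub, map_mul, haK, haK, haK, hmul]
    ring
  have hcb : ∀ g g', algebraMap A K (d (g * g') - d g * d g')
      = (ρ g' : Matrix (Fin 2) (Fin 2) K) 0 1 * (ρ g : Matrix (Fin 2) (Fin 2) K) 1 0 := by
    intro g g'
    rw [map_sub, map_mul, hdK, hdK, hdK, hmul]
    ring
  have hbcm : ∀ g g', a (g * g') - a g * a g' ∈ IsLocalRing.maximalIdeal A := by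
    intro g g'
    rw [← IsLocalRing.residue_eq_zero_iff, map_sub, map_mul, hares, hares, hares, map_mul,
      Units.val_mul, sub_self]
  have ha1 : a 1 = 1 := hinj (by rw [haK, map_one, map_one]; simp)
  have hd1 : d 1 = 1 := hinj (by rw [hdK, map_one, map_one]; simp)
  refine ⟨fun g g' => ⟨_, hbcm g g', hbc g g'⟩, ⟨a, d, fun g => ⟨haK g, hdK g⟩, ?_⟩, ?_⟩
  · generalize hJ : Ideal.span {x : A | ∃ g g' : G, algebraMap A K x
        = (ρ g : Matrix (Fin 2) (Fin 2) K) 0 1 * (ρ g' : Matrix (Fin 2) (Fin 2) K) 1 0} = J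
    have hJm : J ≤ IsLocalRing.maximalIdeal A := by
      rw [← hJ, Ideal.span_le]
      rintro x ⟨g, g', hx⟩
      rw [← hbc] at hx
      exact hinj hx ▸ hbcm g g'
    have hres : ∀ x y : A, Ideal.Quotient.mk J x = Ideal.Quotient.mk J y →
        IsLocalRing.residue A x = IsLocalRing.residue A y := fun x y h =>
      Ideal.Quotient.eq.mpr (hJm (Ideal.Quotient.eq.mp h))
    obtain ⟨ψ₁, hψ₁⟩ := exists_monoidHom_units (fun g => Ideal.Quotient.mk J (a g))
      (by rw [ha1, map_one]) fun g g' => by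
        rw [← map_mul, Ideal.Quotient.eq, ← hJ]
        exact Ideal.subset_span ⟨g, g', hbc g g'⟩
    obtain ⟨ψ₂, hψ₂⟩ := exists_monoidHom_units (fun g => Ideal.Quotient.mk J (d g))
      (by rw [hd1, map_one]) fun g g' => by
        rw [← map_mul, Ideal.Quotient.eq, ← hJ]
        exact Ideal.subset_span ⟨g', g, hcb g g'⟩
    refine ⟨ψ₁, ψ₂, fun g => ⟨hψ₁ g, hψ₂ g⟩, fun g x hx => ?_, fun g x hx => ?_, fun g => ?_⟩
    · rw [← hares]
      exact hres _ _ (hx.trans (hψ₁ g))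
    · rw [← hdres]
      exact hres _ _ (hx.trans (hψ₂ g))
    · rw [hψ₁, hψ₂, hTad, map_add]
  · intro J _ ψ₁ ψ₂ hψT hψ₁ hψ₂
    have hunit : ∀ {x : A}, IsLocalRing.residue A x ≠ 0 → IsUnit (Ideal.Quotient.mk J x) :=
      fun hx => ((IsLocalRing.residue_ne_zero_iff_isUnit _).mp hx).map _
    have has : a s = lam₁ := hinj (by rw [haK, hρs]; simp)
    have hds : d s = lam₂ := hinj (by rw [hdK, hρs]; simp)
    obtain ⟨p, hp⟩ := Ideal.Quotient.mk_surjective (ψ₁ s : A ⧸ J)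
    obtain ⟨q, hq⟩ := Ideal.Quotient.mk_surjective (ψ₂ s : A ⧸ J)
    have hp' := hψ₁ s p hp
    have hq' := hψ₂ s q hq
    have hpow₁ : (ψ₁ s : A ⧸ J) + ψ₂ s
        = Ideal.Quotient.mk J lam₁ + Ideal.Quotient.mk J lam₂ := by
      rw [← hψT, ← map_add, hTad, has, hds]
    have hss : T (s * s) = lam₁ ^ 2 + lam₂ ^ 2 := by rw [hTs', has, hds]; ring
    have hsss : T (s * (s * s)) = lam₁ ^ 3 + lam₂ ^ 3 := by
      refine hinj ?_
      rw [hTs, hmul, hmul, hρs]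
      simp
      ring
    have hpow₂ : (ψ₁ s : A ⧸ J) ^ 2 + (ψ₂ s : A ⧸ J) ^ 2
        = Ideal.Quotient.mk J lam₁ ^ 2 + Ideal.Quotient.mk J lam₂ ^ 2 := by
      rw [← map_pow, ← map_pow, ← map_add, ← hss, hψT, map_mul, map_mul, Units.val_mul,
        Units.val_mul]
      ring
    have hpow₃ : (ψ₁ s : A ⧸ J) ^ 3 + (ψ₂ s : A ⧸ J) ^ 3
        = Ideal.Quotient.mk J lam₁ ^ 3 + Ideal.Quotient.mk J lam₂ ^ 3 := by
      rw [← map_pow, ← map_pow, ← map_add, ← hsss, hψT]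
      simp only [map_mul, Units.val_mul]
      ring
    have hψ₁s : (ψ₁ s : A ⧸ J) = Ideal.Quotient.mk J lam₁ := by
      refine eq_of_power_sums_eq_s14 hpow₁ hpow₂ hpow₃ ?_ ?_
      · rw [← hp, ← hq, ← map_sub]
        exact hunit (by rwa [map_sub, hp', hq'])
      · rw [← hp, ← map_sub]
        exact hunit (by rwa [map_sub, hp', hlam₂])
    have hψ₂s : (ψ₂ s : A ⧸ J) = Ideal.Quotient.mk J lam₂ := by
      linear_combination hpow₁ - hψ₁s
    have huJ : (Ideal.Quotient.mk J lam₁ - Ideal.Quotient.mk J lam₂) * Ideal.Quotient.mk J u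
        = 1 := by
      rw [← map_sub, ← map_mul, hu, map_one]
    have haJ : ∀ g, Ideal.Quotient.mk J (a g) = ψ₁ g := by
      intro g
      rw [ha, map_mul, map_sub, map_mul, hψT, hψT, map_mul, map_mul, Units.val_mul,
        Units.val_mul, hψ₁s, hψ₂s]
      linear_combination (ψ₁ g : A ⧸ J) * huJ
    rw [Ideal.span_le]
    rintro x ⟨g, g', hx⟩
    rw [← hbc] at hx
    rw [hinj hx, SetLike.mem_coe, ← Ideal.Quotient.eq_zero_iff_mem, map_sub, map_mul, haJ, haJ,
      haJ, map_mul, Units.val_mul, sub_self]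
end
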